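/- arXiv:1608.07859 — 5 statements merged into one kernel-verified Lean document; each statement's English description precedes it below -/
import Mathlib

section
/- Let ω be a weight function satisfying (γ)_0, (δ), and (ε)_0 (respectively (ε)_∞). Then there exists a weight function σ, equivalent to ω, which satisfies (δ), (ε)_0 (respectively (ε)_∞), and the additional condition (ζ): for every λ > 1, σ(λt) − σ(t) → ∞ as t → ∞. -/
open MeasureTheory Set Filter

/-- The average of `ω` over `[t, K t]` with respect to the logarithmic measure. -/
noncomputable def logAverage (ω : ℝ → ℝ) (K t : ℝ) : ℝ := ∫ u in (0:ℝ)..1, ω (K ^ u * t)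

section LogAverage

variable {ω : ℝ → ℝ} {K : ℝ}

lemma monotone_comp_rpow_mul (hmono : MonotoneOn ω (Ici (0:ℝ))) (hK : 1 < K) {t : ℝ}
    (ht : 0 ≤ t) : Monotone fun u : ℝ => ω (K ^ u * t) := by
  intro u v huv
  have hK0 : 0 < K := by linarith
  exact hmono (mul_nonneg (Real.rpow_pos_of_pos hK0 _).le ht)
    (mul_nonneg (Real.rpow_pos_of_pos hK0 _).le ht)
    (mul_le_mul_of_nonneg_right (Real.rpow_le_rpow_of_exponent_le hK.le huv) ht)

lemma intervalIntegrable_comp_rpow_mul (hmono : MonotoneOn ω (Ici (0:ℝ))) (hK : 1 < K) {t : ℝ}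
    (ht : 0 ≤ t) (a b : ℝ) : IntervalIntegrable (fun u : ℝ => ω (K ^ u * t)) volume a b :=
  (monotone_comp_rpow_mul hmono hK ht).intervalIntegrable

lemma logAverage_nonneg (hnn : ∀ t, 0 ≤ ω t) (K t : ℝ) : 0 ≤ logAverage ω K t :=
  intervalIntegral.integral_nonneg zero_le_one fun _ _ => hnn _

lemma logAverage_abs (heven : ∀ t, ω t = ω |t|) (K t : ℝ) :
    logAverage ω K t = logAverage ω K |t| := by
  unfold logAverage
  congr 1 with u
  rw [heven (K ^ u * t), heven (K ^ u * |t|), abs_mul, abs_mul, abs_abs]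

lemma logAverage_monotoneOn (hmono : MonotoneOn ω (Ici (0:ℝ))) (hK : 1 < K) :
    MonotoneOn (logAverage ω K) (Ici (0:ℝ)) := by
  intro s hs t ht hst
  refine intervalIntegral.integral_mono_on zero_le_one
    (intervalIntegrable_comp_rpow_mul hmono hK hs 0 1)
    (intervalIntegrable_comp_rpow_mul hmono hK ht 0 1) fun u _ => ?_
  have hu : 0 ≤ K ^ u := Real.rpow_nonneg (by linarith) u
  exact hmono (mul_nonneg hu hs) (mul_nonneg hu ht) (mul_le_mul_of_nonneg_left hst hu)

lemma le_logAverage (hmono : MonotoneOn ω (Ici (0:ℝ))) (hK : 1 < K) {t : ℝ} (ht : 0 ≤ t) :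
    ω t ≤ logAverage ω K t := by
  have h := intervalIntegral.integral_mono_on zero_le_one
    (intervalIntegrable_const (c := ω t)) (intervalIntegrable_comp_rpow_mul hmono hK ht 0 1)
    fun u hu => by simpa using monotone_comp_rpow_mul hmono hK ht hu.1
  simpa [logAverage] using h

lemma logAverage_le (hmono : MonotoneOn ω (Ici (0:ℝ))) (hK : 1 < K) {t : ℝ} (ht : 0 ≤ t) :
    logAverage ω K t ≤ ω (K * t) := by
  have h := intervalIntegral.integral_mono_on zero_le_one
    (intervalIntegrable_comp_rpow_mul hmono hK ht 0 1) (intervalIntegrable_const (c := ω (K * t)))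
    fun u hu => by simpa using monotone_comp_rpow_mul hmono hK ht hu.2
  simpa [logAverage] using h

lemma logAverage_two_mul_le (hmono : MonotoneOn ω (Ici (0:ℝ))) (hK : 1 < K) {C : ℝ}
    (hC : ∀ t, 0 ≤ t → 2 * ω t ≤ ω (K * t) + C) {t : ℝ} (ht : 0 ≤ t) :
    2 * logAverage ω K t ≤ logAverage ω K (K ^ 2 * t) + C := by
  have hK0 : 0 ≤ K := by linarith
  have h₁ := logAverage_le hmono hK ht
  have h₂ := hC (K * t) (by positivity)
  have h₃ := le_logAverage hmono hK (t := K ^ 2 * t) (by positivity)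
  rw [← mul_assoc, ← sq] at h₂
  linarith

lemma logAverage_rpow_mul_sub (hmono : MonotoneOn ω (Ici (0:ℝ))) (hK : 1 < K) {t : ℝ}
    (ht : 0 ≤ t) (v : ℝ) :
    logAverage ω K (K ^ v * t) - logAverage ω K t =
      ∫ u in (0:ℝ)..v, (ω (K * (K ^ u * t)) - ω (K ^ u * t)) := by
  have hK0 : 0 < K := by linarith
  have hint := intervalIntegrable_comp_rpow_mul hmono hK ht
  have h₁ : logAverage ω K (K ^ v * t) = ∫ u in v..(1 + v), ω (K ^ u * t) := by
    have h := intervalIntegral.integral_comp_add_right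
      (fun u => ω (K ^ u * t)) (a := 0) (b := 1) v
    rw [zero_add] at h
    rw [← h, logAverage]
    congr 1 with u
    rw [Real.rpow_add hK0, mul_assoc]
  have h_shift : ∀ u : ℝ, ω (K * (K ^ u * t)) = ω (K ^ (u + 1) * t) := fun u => by
    rw [Real.rpow_add hK0, Real.rpow_one]; ring_nf
  have h₂ : ∫ u in (0:ℝ)..v, ω (K * (K ^ u * t)) = ∫ u in (1:ℝ)..(1 + v), ω (K ^ u * t) := by
    have h := intervalIntegral.integral_comp_add_right
      (fun u => ω (K ^ u * t)) (a := 0) (b := v) 1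
    rw [zero_add, add_comm v 1] at h
    rw [← h]
    simp_rw [h_shift]
  have h₃ : IntervalIntegrable (fun u : ℝ => ω (K * (K ^ u * t))) volume 0 v := by
    simp_rw [h_shift]
    exact Monotone.intervalIntegrable fun a b hab =>
      monotone_comp_rpow_mul hmono hK ht (by linarith)
  rw [intervalIntegral.integral_sub h₃ (hint 0 v), h₂, h₁, logAverage,
    ← intervalIntegral.integral_add_adjacent_intervals (hint v 1) (hint 1 (1 + v)),
    ← intervalIntegral.integral_add_adjacent_intervals (hint 0 v) (hint v 1)]
  ring

lemma tendsto_logAverage_mul_sub (hmono : MonotoneOn ω (Ici (0:ℝ))) (hK : 1 < K) {C : ℝ}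
    (hC : ∀ t, 0 ≤ t → 2 * ω t ≤ ω (K * t) + C) (hω : Tendsto ω atTop atTop) {l : ℝ}
    (hl : 1 < l) : Tendsto (fun t => logAverage ω K (l * t) - logAverage ω K t) atTop atTop := by
  have hK0 : 0 < K := by linarith
  obtain ⟨v, hv, rfl⟩ : ∃ v : ℝ, 0 < v ∧ K ^ v = l :=
    ⟨Real.logb K l, Real.logb_pos hK hl, Real.rpow_logb hK0 hK.ne' (by linarith)⟩
  have hlim : Tendsto (fun t => v * (ω t - C)) atTop atTop :=
    (tendsto_atTop_add_const_right _ (-C) hω).const_mul_atTop hv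
  refine tendsto_atTop_mono' _ ?_ hlim
  filter_upwards [eventually_ge_atTop 0] with t ht
  rw [logAverage_rpow_mul_sub hmono hK ht]
  have hint := intervalIntegrable_comp_rpow_mul hmono hK ht 0 v
  have h_shift : IntervalIntegrable (fun u : ℝ => ω (K * (K ^ u * t))) volume 0 v := by
    have h := intervalIntegrable_comp_rpow_mul hmono hK (mul_nonneg hK0.le ht) 0 v
    simpa only [mul_left_comm] using h
  have h := intervalIntegral.integral_mono_on hv.le
    (intervalIntegrable_const (c := ω t - C)) (h_shift.sub hint) fun u hu => by
      have h₁ := hC (K ^ u * t) (mul_nonneg (Real.rpow_nonneg hK0.le u) ht)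
      have h₂ : ω t ≤ ω (K ^ u * t) := by
        simpa using monotone_comp_rpow_mul hmono hK ht hu.1
      linarith
  simpa only [intervalIntegral.integral_const, sub_zero, smul_eq_mul] using h

lemma integrableOn_logAverage_mul_exp (hnn : ∀ t, 0 ≤ ω t) (hmono : MonotoneOn ω (Ici (0:ℝ)))
    (hK : 1 < K) {μ : ℝ}
    (hint : IntegrableOn (fun t => ω t * Real.exp (-(μ * t))) (Ici (0:ℝ))) :
    IntegrableOn (fun t => logAverage ω K t * Real.exp (-(K * μ * t))) (Ici (0:ℝ)) := by
  have hK0 : 0 < K := by linarith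
  have hdom : IntegrableOn (fun t => ω (K * t) * Real.exp (-(μ * (K * t)))) (Ici (0:ℝ)) := by
    rw [integrableOn_Ici_iff_integrableOn_Ioi] at hint ⊢
    rw [← mul_zero K] at hint
    exact (integrableOn_Ioi_comp_mul_left_iff _ 0 hK0).2 hint
  refine Integrable.mono' hdom ?_ ?_
  · exact ((aemeasurable_restrict_of_monotoneOn measurableSet_Ici
      (logAverage_monotoneOn hmono hK)).mul (by fun_prop)).aestronglyMeasurable
  · filter_upwards [ae_restrict_mem measurableSet_Ici] with t ht
    rw [Real.norm_of_nonneg (mul_nonneg (logAverage_nonneg hnn K t) (Real.exp_pos _).le),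
      show K * μ * t = μ * (K * t) by ring]
    exact mul_le_mul_of_nonneg_right (logAverage_le hmono hK ht) (Real.exp_pos _).le

end LogAverage

lemma tendsto_atTop_of_div_log {ω : ℝ → ℝ}
    (hγ : Tendsto (fun t => ω t / Real.log t) atTop atTop) : Tendsto ω atTop atTop := by
  refine (hγ.atTop_mul_atTop₀ Real.tendsto_log_atTop).congr' ?_
  filter_upwards [eventually_gt_atTop 1] with t ht
  exact div_mul_cancel₀ _ (Real.log_pos ht).ne'

/-- Given a weight function `ω` satisfying `(γ)_0`, `(δ)`, and `(ε)_0`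
(resp. `(ε)_∞`), there is an equivalent weight function `σ` satisfying `(δ)`, `(ε)_0`
(resp. `(ε)_∞`) and `(ζ)`. -/
theorem stmt_1 (ω : ℝ → ℝ)
    (hnn : ∀ t, 0 ≤ ω t)
    (hmono : MonotoneOn ω (Ici (0:ℝ)))
    (heven : ∀ t : ℝ, ω t = ω |t|)
    (hγ : Tendsto (fun t => ω t / Real.log t) atTop atTop)
    (hδ : ∃ A : ℝ, 1 ≤ A ∧ ∃ H : ℝ, 1 ≤ H ∧ ∀ t : ℝ, 0 ≤ t → 2 * ω t ≤ ω (H * t) + Real.log A) :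
    ((∀ μ : ℝ, 0 < μ →
        IntegrableOn (fun t => ω t * Real.exp (-(μ * t))) (Ici (0:ℝ))) →
      ∃ σ : ℝ → ℝ, (∀ t, 0 ≤ σ t) ∧ MonotoneOn σ (Ici (0:ℝ)) ∧ (∀ t : ℝ, σ t = σ |t|) ∧
        -- σ is equivalent to ω
        (∃ l₁ : ℝ, 0 < l₁ ∧ ∃ C₁ : ℝ, 0 < C₁ ∧ ∀ t : ℝ, 0 ≤ t → σ t ≤ ω (l₁ * t) + C₁) ∧
        (∃ l₂ : ℝ, 0 < l₂ ∧ ∃ C₂ : ℝ, 0 < C₂ ∧ ∀ t : ℝ, 0 ≤ t → ω t ≤ σ (l₂ * t) + C₂) ∧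
        -- σ satisfies (δ)
        (∃ A : ℝ, 1 ≤ A ∧ ∃ H : ℝ, 1 ≤ H ∧ ∀ t : ℝ, 0 ≤ t → 2 * σ t ≤ σ (H * t) + Real.log A) ∧
        -- σ satisfies (ε)_0
        (∀ μ : ℝ, 0 < μ →
          IntegrableOn (fun t => σ t * Real.exp (-(μ * t))) (Ici (0:ℝ))) ∧
        -- σ satisfies (ζ)
        (∀ l : ℝ, 1 < l → Tendsto (fun t => σ (l * t) - σ t) atTop atTop)) ∧
    ((∃ μ : ℝ, 0 < μ ∧
        IntegrableOn (fun t => ω t * Real.exp (-(μ * t))) (Ici (0:ℝ))) →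
      ∃ σ : ℝ → ℝ, (∀ t, 0 ≤ σ t) ∧ MonotoneOn σ (Ici (0:ℝ)) ∧ (∀ t : ℝ, σ t = σ |t|) ∧
        (∃ l₁ : ℝ, 0 < l₁ ∧ ∃ C₁ : ℝ, 0 < C₁ ∧ ∀ t : ℝ, 0 ≤ t → σ t ≤ ω (l₁ * t) + C₁) ∧
        (∃ l₂ : ℝ, 0 < l₂ ∧ ∃ C₂ : ℝ, 0 < C₂ ∧ ∀ t : ℝ, 0 ≤ t → ω t ≤ σ (l₂ * t) + C₂) ∧
        (∃ A : ℝ, 1 ≤ A ∧ ∃ H : ℝ, 1 ≤ H ∧ ∀ t : ℝ, 0 ≤ t → 2 * σ t ≤ σ (H * t) + Real.log A) ∧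
        (∃ μ : ℝ, 0 < μ ∧
          IntegrableOn (fun t => σ t * Real.exp (-(μ * t))) (Ici (0:ℝ))) ∧
        (∀ l : ℝ, 1 < l → Tendsto (fun t => σ (l * t) - σ t) atTop atTop)) := by
  obtain ⟨A, hA, H, hH, hAH⟩ := hδ
  obtain ⟨K, hHK, hK⟩ : ∃ K : ℝ, H ≤ K ∧ 1 < K := ⟨H + 1, by linarith, by linarith⟩
  have hK0 : 0 < K := by linarith
  have hC : ∀ t, 0 ≤ t → 2 * ω t ≤ ω (K * t) + Real.log A := fun t ht =>
    (hAH t ht).trans <| by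
      gcongr
      exact hmono (mul_nonneg (by linarith) ht) (mul_nonneg hK0.le ht)
        (mul_le_mul_of_nonneg_right hHK ht)
  have hupper : ∃ l₁ : ℝ, 0 < l₁ ∧ ∃ C₁ : ℝ, 0 < C₁ ∧
      ∀ t : ℝ, 0 ≤ t → logAverage ω K t ≤ ω (l₁ * t) + C₁ :=
    ⟨K, hK0, 1, one_pos, fun t ht => by linarith [logAverage_le hmono hK ht]⟩
  have hlower : ∃ l₂ : ℝ, 0 < l₂ ∧ ∃ C₂ : ℝ, 0 < C₂ ∧
      ∀ t : ℝ, 0 ≤ t → ω t ≤ logAverage ω K (l₂ * t) + C₂ :=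
    ⟨1, one_pos, 1, one_pos, fun t ht => by
      rw [one_mul]
      linarith [le_logAverage hmono hK ht]⟩
  have hdouble : ∃ A : ℝ, 1 ≤ A ∧ ∃ H : ℝ, 1 ≤ H ∧
      ∀ t : ℝ, 0 ≤ t → 2 * logAverage ω K t ≤ logAverage ω K (H * t) + Real.log A :=
    ⟨A, hA, K ^ 2, one_le_pow₀ hK.le, fun t ht => logAverage_two_mul_le hmono hK hC ht⟩
  have hζ : ∀ l : ℝ, 1 < l →
      Tendsto (fun t => logAverage ω K (l * t) - logAverage ω K t) atTop atTop := fun l hl =>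
    tendsto_logAverage_mul_sub hmono hK hC (tendsto_atTop_of_div_log hγ) hl
  refine ⟨fun hε => ?_, fun ⟨μ, hμ, hε⟩ => ?_⟩
  · refine ⟨logAverage ω K, logAverage_nonneg hnn K, logAverage_monotoneOn hmono hK,
      logAverage_abs heven K, hupper, hlower, hdouble, fun μ hμ => ?_, hζ⟩
    have h := integrableOn_logAverage_mul_exp hnn hmono hK (hε (μ / K) (div_pos hμ hK0))
    rwa [mul_div_cancel₀ _ hK0.ne'] at h
  · exact ⟨logAverage ω K, logAverage_nonneg hnn K, logAverage_monotoneOn hmono hK,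
      logAverage_abs heven K, hupper, hlower, hdouble, ⟨K * μ, mul_pos hK0 hμ,
      integrableOn_logAverage_mul_exp hnn hmono hK hε⟩, hζ⟩
end

section
/- Let ω be a weight function satisfying (ε)_0 (respectively (ε)_∞). Then there is a weight function σ satisfying (ε)_0 (respectively (ε)_∞) and (δ), and such that ω(t) ≤ σ(t) for all t ≥ 0. -/
open MeasureTheory Set Filter

/-- Multiplying by `1 + |t|` preserves exponentially weighted integrability on the half line,
at the cost of doubling the exponent. -/
theorem integrableOn_one_add_abs_mul_exp {f : ℝ → ℝ} {μ : ℝ} (hμ : 0 < μ)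
    (hf : IntegrableOn (fun t => f t * Real.exp (-(μ * t))) (Ici (0:ℝ))) :
    IntegrableOn (fun t => (1 + |t|) * f t * Real.exp (-((2 * μ) * t))) (Ici (0:ℝ)) := by
  have hb : ∀ᵐ t ∂(volume.restrict (Ici (0:ℝ))),
      ‖(1 + |t|) * Real.exp (-(μ * t))‖ ≤ 1 + 1 / μ := by
    filter_upwards [ae_restrict_mem measurableSet_Ici] with t ht
    have ht : 0 ≤ t := ht
    rw [Real.norm_of_nonneg (by positivity), abs_of_nonneg ht, Real.exp_neg, ← div_eq_mul_inv,
      div_le_iff₀ (Real.exp_pos _)]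
    have h1 : 1 + μ * t ≤ Real.exp (μ * t) := by linarith [Real.add_one_le_exp (μ * t)]
    calc 1 + t ≤ (1 + 1 / μ) * (1 + μ * t) := by
          have : (1 + 1 / μ) * (1 + μ * t) = 1 + t + (μ * t + 1 / μ) := by field_simp; ring
          rw [this]
          have : 0 ≤ μ * t + 1 / μ := by positivity
          linarith
      _ ≤ _ := by gcongr
  have hc : Continuous fun t : ℝ => (1 + |t|) * Real.exp (-(μ * t)) := by fun_prop
  refine (Integrable.bdd_mul hf hc.aestronglyMeasurable hb).congr (ae_of_all _ fun t => ?_)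
  have : Real.exp (-((2 * μ) * t)) = Real.exp (-(μ * t)) * Real.exp (-(μ * t)) := by
    rw [← Real.exp_add]; ring_nf
  simp only [this]
  ring

/-- If `ω` is a weight function, then `(1 + |t|) * ω t` satisfies `(δ)`. -/
theorem exists_two_mul_one_add_abs_mul_le {ω : ℝ → ℝ} (hnn : ∀ t, 0 ≤ ω t)
    (hmono : MonotoneOn ω (Ici (0:ℝ))) :
    ∃ A : ℝ, 1 ≤ A ∧ ∃ H : ℝ, 1 ≤ H ∧ ∀ t : ℝ, 0 ≤ t →
      2 * ((1 + |t|) * ω t) ≤ (1 + |H * t|) * ω (H * t) + Real.log A := by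
  refine ⟨Real.exp (4 * ω 1), Real.one_le_exp (by linarith [hnn 1]), 4, by norm_num,
    fun t ht => ?_⟩
  rw [Real.log_exp, abs_of_nonneg ht, abs_of_nonneg (by positivity : 0 ≤ 4 * t)]
  rcases le_total t 1 with h | h
  · have h1 : ω t ≤ ω 1 := hmono ht (zero_le_one : (0:ℝ) ≤ 1) h
    have h2 : (1 + t) * ω t ≤ 2 * ω 1 :=
      mul_le_mul (by linarith) h1 (hnn t) (by norm_num)
    have h3 : 0 ≤ (1 + 4 * t) * ω (4 * t) := mul_nonneg (by positivity) (hnn _)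
    linarith
  · have h1 : ω t ≤ ω (4 * t) := hmono ht (by positivity : 0 ≤ 4 * t) (by linarith)
    have h2 : (2 * (1 + t)) * ω t ≤ (1 + 4 * t) * ω (4 * t) :=
      mul_le_mul (by linarith) h1 (hnn t) (by positivity)
    linarith [hnn 1]

/-- A weight function `ω` satisfying `(ε)_0` (resp. `(ε)_∞`) is majorized by a
weight function `σ` satisfying `(ε)_0` (resp. `(ε)_∞`) and `(δ)`. -/
theorem stmt_2 (ω : ℝ → ℝ)
    (hnn : ∀ t, 0 ≤ ω t)
    (hmono : MonotoneOn ω (Ici (0:ℝ)))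
    (heven : ∀ t : ℝ, ω t = ω |t|) :
    ((∀ μ : ℝ, 0 < μ →
        IntegrableOn (fun t => ω t * Real.exp (-(μ * t))) (Ici (0:ℝ))) →
      ∃ σ : ℝ → ℝ, (∀ t, 0 ≤ σ t) ∧ MonotoneOn σ (Ici (0:ℝ)) ∧ (∀ t : ℝ, σ t = σ |t|) ∧
        (∀ μ : ℝ, 0 < μ →
          IntegrableOn (fun t => σ t * Real.exp (-(μ * t))) (Ici (0:ℝ))) ∧
        (∃ A : ℝ, 1 ≤ A ∧ ∃ H : ℝ, 1 ≤ H ∧ ∀ t : ℝ, 0 ≤ t → 2 * σ t ≤ σ (H * t) + Real.log A) ∧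
        (∀ t : ℝ, 0 ≤ t → ω t ≤ σ t)) ∧
    ((∃ μ : ℝ, 0 < μ ∧
        IntegrableOn (fun t => ω t * Real.exp (-(μ * t))) (Ici (0:ℝ))) →
      ∃ σ : ℝ → ℝ, (∀ t, 0 ≤ σ t) ∧ MonotoneOn σ (Ici (0:ℝ)) ∧ (∀ t : ℝ, σ t = σ |t|) ∧
        (∃ μ : ℝ, 0 < μ ∧
          IntegrableOn (fun t => σ t * Real.exp (-(μ * t))) (Ici (0:ℝ))) ∧
        (∃ A : ℝ, 1 ≤ A ∧ ∃ H : ℝ, 1 ≤ H ∧ ∀ t : ℝ, 0 ≤ t → 2 * σ t ≤ σ (H * t) + Real.log A) ∧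
        (∀ t : ℝ, 0 ≤ t → ω t ≤ σ t)) := by
  have hσnn : ∀ t : ℝ, 0 ≤ (1 + |t|) * ω t := fun t => mul_nonneg (by positivity) (hnn t)
  have hσmono : MonotoneOn (fun t => (1 + |t|) * ω t) (Ici (0:ℝ)) := by
    intro a ha b hb hab
    refine mul_le_mul ?_ (hmono ha hb hab) (hnn a) (by positivity)
    rw [abs_of_nonneg ha, abs_of_nonneg hb]
    linarith
  have hσeven : ∀ t : ℝ, (1 + |t|) * ω t = (1 + |(|t|)|) * ω |t| := fun t => by
    rw [abs_abs, ← heven t]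
  have hle : ∀ t : ℝ, 0 ≤ t → ω t ≤ (1 + |t|) * ω t := fun t _ =>
    le_mul_of_one_le_left (hnn t) (by linarith [abs_nonneg t])
  have hδ := exists_two_mul_one_add_abs_mul_le hnn hmono
  refine ⟨fun h => ⟨fun t => (1 + |t|) * ω t, hσnn, hσmono, hσeven, fun μ hμ => ?_, hδ, hle⟩,
    fun ⟨μ, hμ, h⟩ => ⟨fun t => (1 + |t|) * ω t, hσnn, hσmono, hσeven,
      ⟨2 * μ, by positivity, integrableOn_one_add_abs_mul_exp hμ h⟩, hδ, hle⟩⟩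
  have := integrableOn_one_add_abs_mul_exp (half_pos hμ) (h (μ / 2) (half_pos hμ))
  rwa [mul_div_cancel₀ μ two_ne_zero] at this
end

section
/- Let ω be a weight function satisfying (ε)_0. Then there is a weight function σ satisfying (ε)_0 such that for every λ > 0, ω(λt) = o(σ(t)) as t → ∞. -/
open MeasureTheory Set Filter

/-- A nonnegative function, nondecreasing on `[0, ∞)` and integrable against `exp (-μ t)`,
is dominated by a multiple of `exp (μ t)`. -/
lemma exists_le_mul_exp_of_integrableOn {ω : ℝ → ℝ} (hnn : ∀ t, 0 ≤ ω t)
    (hmono : MonotoneOn ω (Ici (0:ℝ))) {μ : ℝ} (hμ : 0 < μ)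
    (hint : IntegrableOn (fun t => ω t * Real.exp (-(μ * t))) (Ici (0:ℝ))) :
    ∃ C : ℝ, ∀ t, 0 ≤ t → ω t ≤ C * Real.exp (μ * t) := by
  refine ⟨(∫ t in Ici (0:ℝ), ω t * Real.exp (-(μ * t))) * Real.exp μ, fun t ht => ?_⟩
  have hsub : Icc t (t + 1) ⊆ Ici (0:ℝ) := fun s hs => ht.trans hs.1
  have hle : ω t * Real.exp (-(μ * (t + 1))) ≤
      ∫ s in Ici (0:ℝ), ω s * Real.exp (-(μ * s)) := by
    calc ω t * Real.exp (-(μ * (t + 1)))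
        = ∫ _ in Icc t (t + 1), ω t * Real.exp (-(μ * (t + 1))) := by simp
      _ ≤ ∫ s in Icc t (t + 1), ω s * Real.exp (-(μ * s)) := by
          refine setIntegral_mono_on (integrableOn_const (by simp)) (hint.mono_set hsub) measurableSet_Icc ?_
          intro s hs
          refine mul_le_mul (hmono ht (hsub hs) hs.1) (Real.exp_le_exp.2 ?_)
            (Real.exp_pos _).le (hnn s)
          nlinarith [hs.2]
      _ ≤ ∫ s in Ici (0:ℝ), ω s * Real.exp (-(μ * s)) :=
          setIntegral_mono_set hint
            (Eventually.of_forall fun s => mul_nonneg (hnn s) (Real.exp_pos _).le)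
            hsub.eventuallyLE
  calc ω t = ω t * Real.exp (-(μ * (t + 1))) * (Real.exp μ * Real.exp (μ * t)) := by
        rw [mul_assoc, ← Real.exp_add, ← Real.exp_add]
        ring_nf
        simp
    _ ≤ (∫ s in Ici (0:ℝ), ω s * Real.exp (-(μ * s))) * (Real.exp μ * Real.exp (μ * t)) := by
        gcongr
    _ = _ := (mul_assoc _ _ _).symm

lemma eventually_nat_mul_le_exp {ω : ℝ → ℝ}
    (hexp : ∀ μ : ℝ, 0 < μ → ∃ C : ℝ, ∀ t, 0 ≤ t → ω t ≤ C * Real.exp (μ * t)) (n : ℕ) :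
    ∀ᶠ t : ℝ in atTop, n * ω (n * t) ≤ Real.exp (t / n) := by
  rcases n.eq_zero_or_pos with rfl | hn
  · simp
  have hn' : (0:ℝ) < n := by exact_mod_cast hn
  obtain ⟨C, hC⟩ := hexp (1 / (2 * n ^ 2)) (by positivity)
  have hlim : Tendsto (fun t : ℝ => Real.exp (t / (2 * n))) atTop atTop :=
    Real.tendsto_exp_atTop.comp (tendsto_id.atTop_div_const (by positivity))
  filter_upwards [hlim.eventually_ge_atTop (n * C), eventually_ge_atTop 0] with t h ht
  calc n * ω (n * t) ≤ n * (C * Real.exp (1 / (2 * n ^ 2) * (n * t))) := by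
        gcongr
        exact hC _ (by positivity)
    _ = n * C * Real.exp (t / (2 * n)) := by
        rw [mul_assoc]
        congr 3
        field_simp
    _ ≤ Real.exp (t / (2 * n)) * Real.exp (t / (2 * n)) := by gcongr
    _ = Real.exp (t / n) := by
        rw [← Real.exp_add]
        congr 1
        field_simp
        ring

/-- Countably many eventual properties hold along a monotone selection of indices
tending to infinity. -/
lemma exists_monotone_tendsto_atTop_of_eventually {P : ℕ → ℝ → Prop}
    (hP : ∀ n, ∀ᶠ t in atTop, P n t) :
    ∃ N : ℝ → ℕ, Monotone N ∧ Tendsto N atTop atTop ∧ ∀ t, N t ≠ 0 → P (N t) t := by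
  classical
  choose T hT using fun n => eventually_atTop.1 (hP n)
  refine ⟨fun t => Nat.findGreatest (fun n => T n ≤ t) ⌊t⌋₊, fun s t hst => ?_, ?_, ?_⟩
  · exact Nat.findGreatest_mono (fun n hn => le_trans hn hst) (Nat.floor_mono hst)
  · refine tendsto_atTop.2 fun n => ?_
    filter_upwards [eventually_ge_atTop (T n), eventually_ge_atTop (n:ℝ)] with t h1 h2
    exact Nat.le_findGreatest (Nat.le_floor h2) h1
  · intro t ht
    exact hT _ _ (Nat.findGreatest_of_ne_zero (P := fun n => T n ≤ t) rfl ht)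

lemma integrableOn_mul_exp_of_eventually_le {σ : ℝ → ℝ} (hnn : ∀ t, 0 ≤ σ t)
    (hmono : MonotoneOn σ (Ici (0:ℝ))) {μ ν : ℝ} (hν : 0 ≤ ν) (hνμ : ν < μ)
    (hle : ∀ᶠ t in atTop, σ t ≤ Real.exp (ν * t)) :
    IntegrableOn (fun t => σ t * Real.exp (-(μ * t))) (Ici (0:ℝ)) := by
  obtain ⟨A, hA⟩ := eventually_atTop.1 (hle.and (eventually_ge_atTop 0))
  have hA0 : 0 ≤ A := (hA A le_rfl).2
  have hdom : IntegrableOn (fun t => (σ A + 1) * Real.exp (-(μ - ν) * t)) (Ici (0:ℝ)) := by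
    rw [integrableOn_Ici_iff_integrableOn_Ioi]
    exact (exp_neg_integrableOn_Ioi 0 (sub_pos.2 hνμ)).const_mul _
  refine Integrable.mono' hdom ?_ ?_
  · exact ((aemeasurable_restrict_of_monotoneOn measurableSet_Ici hmono).mul
      (by fun_prop)).aestronglyMeasurable
  · refine (ae_restrict_iff' measurableSet_Ici).2 (Eventually.of_forall fun t ht => ?_)
    have ht0 : (0:ℝ) ≤ t := ht
    have h1 : 1 ≤ Real.exp (ν * t) := Real.one_le_exp (mul_nonneg hν ht0)
    have hσ : σ t ≤ (σ A + 1) * Real.exp (ν * t) := by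
      rcases le_total t A with h | h
      · nlinarith [hmono ht hA0 h, hnn A]
      · nlinarith [(hA t h).1, hnn A]
    rw [Real.norm_of_nonneg (mul_nonneg (hnn t) (Real.exp_pos _).le)]
    calc σ t * Real.exp (-(μ * t))
        ≤ (σ A + 1) * Real.exp (ν * t) * Real.exp (-(μ * t)) := by gcongr
      _ = (σ A + 1) * Real.exp (-(μ - ν) * t) := by
          rw [mul_assoc, ← Real.exp_add]
          ring_nf

/-- For a weight function `ω` satisfying `(ε)_0` there is a weight function `σ`
satisfying `(ε)_0` such that `ω(λ t) = o(σ(t))` as `t → ∞` for every `λ > 0`. -/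
theorem stmt_3 (ω : ℝ → ℝ)
    (hnn : ∀ t, 0 ≤ ω t)
    (hmono : MonotoneOn ω (Ici (0:ℝ)))
    (heven : ∀ t : ℝ, ω t = ω |t|)
    (hε0 : ∀ μ : ℝ, 0 < μ →
      IntegrableOn (fun t => ω t * Real.exp (-(μ * t))) (Ici (0:ℝ))) :
    ∃ σ : ℝ → ℝ, (∀ t, 0 ≤ σ t) ∧ MonotoneOn σ (Ici (0:ℝ)) ∧ (∀ t : ℝ, σ t = σ |t|) ∧
      (∀ μ : ℝ, 0 < μ →
        IntegrableOn (fun t => σ t * Real.exp (-(μ * t))) (Ici (0:ℝ))) ∧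
      (∀ l : ℝ, 0 < l → (fun t => ω (l * t)) =o[atTop] σ) := by
  obtain ⟨N, hNmono, hNtop, hN⟩ := exists_monotone_tendsto_atTop_of_eventually
    (eventually_nat_mul_le_exp fun μ hμ =>
      exists_le_mul_exp_of_integrableOn hnn hmono hμ (hε0 μ hμ))
  have hNtop' : Tendsto (fun t => (N t : ℝ)) atTop atTop :=
    tendsto_natCast_atTop_atTop.comp hNtop
  let σ : ℝ → ℝ := fun t => N |t| * ω (N |t| * |t|)
  have hσnn : ∀ t, 0 ≤ σ t := fun t => mul_nonneg (Nat.cast_nonneg _) (hnn _)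
  have hσ : ∀ t, 0 ≤ t → σ t = N t * ω (N t * t) := fun t ht => by
    simp only [σ, abs_of_nonneg ht]
  have hσmono : MonotoneOn σ (Ici (0:ℝ)) := by
    intro s hs t ht hst
    have hs0 : (0:ℝ) ≤ s := hs
    have ht0 : (0:ℝ) ≤ t := ht
    have hNst : (N s : ℝ) ≤ N t := by exact_mod_cast hNmono hst
    rw [hσ s hs, hσ t ht]
    refine mul_le_mul hNst (hmono ?_ ?_ ?_) (hnn _) (Nat.cast_nonneg _)
    · exact mul_nonneg (Nat.cast_nonneg _) hs0
    · exact mul_nonneg (Nat.cast_nonneg _) ht0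
    · gcongr
  refine ⟨σ, hσnn, hσmono, fun t => by simp [σ], fun μ hμ => ?_, fun l hl => ?_⟩
  · refine integrableOn_mul_exp_of_eventually_le hσnn hσmono (half_pos hμ).le
      (half_lt_self hμ) ?_
    filter_upwards [eventually_ge_atTop 0, hNtop'.eventually_ge_atTop (2 / μ),
      hNtop.eventually_ge_atTop 1] with t ht h2 h1
    have hNpos : (0:ℝ) < N t := by exact_mod_cast h1
    rw [hσ t ht]
    refine (hN t (Nat.one_le_iff_ne_zero.1 h1)).trans (Real.exp_le_exp.2 ?_)
    rw [div_le_iff₀ hμ] at h2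
    rw [div_le_iff₀ hNpos]
    nlinarith
  · refine Asymptotics.isLittleO_iff.2 fun c hc => ?_
    filter_upwards [eventually_ge_atTop 0, hNtop'.eventually_ge_atTop l,
      hNtop'.eventually_ge_atTop (1 / c)] with t ht hl' hc'
    rw [Real.norm_of_nonneg (hnn _), Real.norm_of_nonneg (hσnn _), hσ t ht]
    have hle : ω (l * t) ≤ ω (N t * t) :=
      hmono (mul_nonneg hl.le ht) (mul_nonneg (Nat.cast_nonneg _) ht) (by gcongr)
    rw [div_le_iff₀ hc] at hc'
    nlinarith [hnn (N t * t)]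
end

section
/- Let (M_p)_{p∈ℕ} be a weight sequence with associated function M and counting function m. The following statements are equivalent: (i) ∫₀^∞ M(t)e^{−μt} dt < ∞ for all μ > 0; (ii) ∫₀^∞ m(t)e^{−μt} dt < ∞ for all μ > 0; (iii) for every λ > 0 there is C > 0 with M(t) ≤ e^{λt} + C for all t ≥ 0; (iv) for every λ > 0 there is C > 0 with m(t) ≤ e^{λt} + C for all t ≥ 0; (v) Σ_{p≥1} e^{−μ m_p} < ∞ for all μ > 0; (vi) for every h > 0, sup_{p∈ℕ} (log(p+e))^{p+e}/(h^p M_p) < ∞. The same equivalences hold if 'for all μ > 0' is replaced by 'for some μ > 0' in (i), (ii), (v), 'for every λ > 0' by 'for some λ > 0' in (iii), (iv), and 'for every h > 0' by 'for some h > 0' in (vi). -/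
open MeasureTheory Set Filter

/-- `f` grows at most like `exp (l * t)` on `[0, ∞)`, up to an additive constant. -/
def ExpBounded (f : ℝ → ℝ) (l : ℝ) : Prop :=
  ∃ C : ℝ, 0 < C ∧ ∀ t : ℝ, 0 ≤ t → f t ≤ Real.exp (l * t) + C

theorem expBounded_of_le_mul_exp {f : ℝ → ℝ} {l : ℝ} (K : ℝ)
    (h : ∀ t, 0 ≤ t → f t ≤ K * Real.exp (l * t)) : ExpBounded f (2 * l) := by
  refine ⟨K ^ 2 + 1, by positivity, fun t ht => (h t ht).trans ?_⟩
  have h2 : Real.exp (2 * l * t) = Real.exp (l * t) ^ 2 := by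
    rw [← Real.exp_nat_mul]; congr 1; push_cast; ring
  rw [h2]
  nlinarith [sq_nonneg (K - Real.exp (l * t)), sq_nonneg K, sq_nonneg (Real.exp (l * t))]

theorem ExpBounded.le_mul_exp {f : ℝ → ℝ} {l : ℝ} (hl : 0 < l) (h : ExpBounded f l) :
    ∃ K : ℝ, 0 < K ∧ ∀ t, 0 ≤ t → f t ≤ K * Real.exp (l * t) := by
  obtain ⟨C, hC, h⟩ := h
  refine ⟨1 + C, by positivity, fun t ht => (h t ht).trans ?_⟩
  have : 1 ≤ Real.exp (l * t) := Real.one_le_exp (by positivity)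
  nlinarith

theorem ExpBounded.integrableOn {f : ℝ → ℝ} (hf : MonotoneOn f (Ici 0))
    (h0 : ∀ t, 0 ≤ t → 0 ≤ f t) {l : ℝ} (hl : 0 < l) (h : ExpBounded f l) :
    IntegrableOn (fun t => f t * Real.exp (-(2 * l * t))) (Ici (0 : ℝ)) := by
  obtain ⟨K, hK, h⟩ := h.le_mul_exp hl
  have hint : IntegrableOn (fun t => K * Real.exp (-l * t)) (Ici (0 : ℝ)) := by
    rw [integrableOn_Ici_iff_integrableOn_Ioi]
    exact (exp_neg_integrableOn_Ioi 0 hl).const_mul K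
  refine Integrable.mono' hint ?_ ?_
  · refine ((aemeasurable_restrict_of_monotoneOn measurableSet_Ici hf).mul ?_).aestronglyMeasurable
    fun_prop
  · filter_upwards [ae_restrict_mem measurableSet_Ici] with t ht
    have ht : 0 ≤ t := ht
    rw [Real.norm_of_nonneg (mul_nonneg (h0 t ht) (Real.exp_pos _).le)]
    calc f t * Real.exp (-(2 * l * t))
        ≤ K * Real.exp (l * t) * Real.exp (-(2 * l * t)) := by gcongr; exact h t ht
      _ = K * Real.exp (-l * t) := by
        rw [mul_assoc, ← Real.exp_add]; congr 2; ring

theorem expBounded_of_integrableOn {f : ℝ → ℝ} (hf : MonotoneOn f (Ici 0))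
    (h0 : ∀ t, 0 ≤ t → 0 ≤ f t) {μ : ℝ} (hμ : 0 < μ)
    (h : IntegrableOn (fun t => f t * Real.exp (-(μ * t))) (Ici (0 : ℝ))) :
    ExpBounded f (2 * μ) := by
  refine expBounded_of_le_mul_exp
    (μ * ∫ t in Ici (0 : ℝ), f t * Real.exp (-(μ * t))) fun t ht => ?_
  have hsub : Ioi t ⊆ Ici 0 := fun s hs => ht.trans (le_of_lt hs)
  have hmono : ∫ s in Ioi t, f t * Real.exp (-μ * s)
      ≤ ∫ s in Ioi t, f s * Real.exp (-(μ * s)) := by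
    refine setIntegral_mono_on ((exp_neg_integrableOn_Ioi t hμ).const_mul _)
      (h.mono_set hsub) measurableSet_Ioi fun s hs => ?_
    rw [neg_mul]
    gcongr
    exact hf ht (hsub hs) (le_of_lt hs)
  have hset : ∫ s in Ioi t, f s * Real.exp (-(μ * s))
      ≤ ∫ s in Ici (0 : ℝ), f s * Real.exp (-(μ * s)) := by
    refine setIntegral_mono_set h ?_ (LE.le.eventuallyLE hsub)
    filter_upwards [ae_restrict_mem measurableSet_Ici] with s hs
    exact mul_nonneg (h0 s hs) (Real.exp_pos _).le
  have key := hmono.trans hset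
  rw [integral_const_mul, integral_exp_mul_Ioi (by linarith : -μ < 0) t] at key
  have he : f t * (-Real.exp (-μ * t) / -μ) * (μ * Real.exp (μ * t)) = f t := by
    have : Real.exp (-μ * t) * Real.exp (μ * t) = 1 := by
      rw [← Real.exp_add]; simp
    rw [neg_div_neg_eq]
    calc f t * (Real.exp (-μ * t) / μ) * (μ * Real.exp (μ * t))
        = f t * (Real.exp (-μ * t) * Real.exp (μ * t)) * (μ / μ) := by ring
      _ = f t := by rw [this, div_self hμ.ne', mul_one, mul_one]
  calc f t = f t * (-Real.exp (-μ * t) / -μ) * (μ * Real.exp (μ * t)) := he.symm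
    _ ≤ _ := mul_le_mul_of_nonneg_right key (by positivity)
    _ = _ := by ring

section Sequences

variable {q : ℕ → ℝ} {f n : ℝ → ℝ}

/-- `n` counts, on `[0, ∞)`, the members of the nondecreasing sequence `q`. -/
def IsCounting (q : ℕ → ℝ) (n : ℝ → ℝ) : Prop :=
  ∀ t : ℝ, 0 ≤ t → ∃ N : ℕ, n t = N ∧ ∀ p, q p ≤ t ↔ p < N

/-- `f` is, on `(0, ∞)`, the associated function of the weight sequence with quotients `q`. -/
def IsAssociated (q : ℕ → ℝ) (f : ℝ → ℝ) : Prop :=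
  ∀ t : ℝ, 0 < t → IsLUB (range fun p : ℕ => ∑ j ∈ Finset.range p, Real.log (t / q j)) (f t)

theorem exists_le_iff_lt (hq : Monotone q) (hlim : Tendsto q atTop atTop) (t : ℝ) :
    ∃ N : ℕ, ∀ p, q p ≤ t ↔ p < N := by
  classical
  have hex : ∃ p, t < q p := (hlim.eventually_gt_atTop t).exists
  refine ⟨Nat.find hex, fun p => ⟨fun hp => ?_, fun hp => not_lt.1 (Nat.find_min hex hp)⟩⟩
  by_contra! hle
  exact absurd ((Nat.find_spec hex).trans_le (hq hle)) (not_lt.2 hp)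

theorem IsCounting.nonneg (hn : IsCounting q n) : ∀ t, 0 ≤ t → 0 ≤ n t := by
  intro t ht
  obtain ⟨N, hN, -⟩ := hn t ht
  rw [hN]
  positivity

theorem IsCounting.monotoneOn (hn : IsCounting q n) : MonotoneOn n (Ici 0) := by
  intro s hs t ht hst
  obtain ⟨N, hN, hN'⟩ := hn s hs
  obtain ⟨K, hK, hK'⟩ := hn t ht
  rw [hN, hK]
  norm_cast
  by_contra! hlt
  exact lt_irrefl K ((hK' K).1 (((hN' K).2 hlt).trans hst))

theorem IsAssociated.nonneg (hf : IsAssociated q f) (hf0 : f 0 = 0) : ∀ t, 0 ≤ t → 0 ≤ f t := by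
  intro t ht
  rcases ht.eq_or_lt with rfl | ht
  · exact hf0.ge
  · exact (hf t ht).1 ⟨0, by simp⟩

theorem IsAssociated.monotoneOn (hq : ∀ p, 0 < q p) (hf : IsAssociated q f) (hf0 : f 0 = 0) :
    MonotoneOn f (Ici 0) := by
  intro s hs t ht hst
  rcases (show (0 : ℝ) ≤ s from hs).eq_or_lt with rfl | hs
  · rw [hf0]; exact hf.nonneg hf0 t ht
  · refine (hf s hs).2 ?_
    rintro _ ⟨p, rfl⟩
    refine le_trans ?_ ((hf t (hs.trans_le hst)).1 ⟨p, rfl⟩)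
    refine Finset.sum_le_sum fun j _ => ?_
    have := hq j
    gcongr

theorem IsAssociated.le_counting_mul (hq : ∀ p, 0 < q p) (hmono : Monotone q)
    (hf : IsAssociated q f) (hn : IsCounting q n) {t : ℝ} (ht : 0 < t) :
    f t ≤ n t * (t / q 0) := by
  obtain ⟨N, hN, hN'⟩ := hn t ht.le
  have h0 := hq 0
  refine (hf t ht).2 ?_
  rintro _ ⟨p, rfl⟩
  calc ∑ j ∈ Finset.range p, Real.log (t / q j)
      ≤ ∑ j ∈ Finset.range p, if j < N then t / q 0 else 0 := by
        refine Finset.sum_le_sum fun j _ => ?_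
        have hj := hq j
        split_ifs with h
        · have : t / q j ≤ t / q 0 := by gcongr; exact hmono (Nat.zero_le j)
          linarith [Real.log_le_sub_one_of_pos (div_pos ht hj)]
        · refine Real.log_nonpos (by positivity) ((div_le_one hj).2 ?_)
          exact (not_le.1 fun hle => h ((hN' j).1 hle)).le
    _ = ((Finset.range p).filter (· < N)).card * (t / q 0) := by
        rw [← Finset.sum_filter, Finset.sum_const, nsmul_eq_mul]
    _ ≤ n t * (t / q 0) := by
        rw [hN]
        gcongr
        refine (Finset.card_le_card (t := Finset.range N) fun j hj => ?_).trans_eq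
          (Finset.card_range N)
        exact Finset.mem_range.2 (Finset.mem_filter.1 hj).2

theorem IsCounting.le_associated (hq : ∀ p, 0 < q p) (hf : IsAssociated q f)
    (hn : IsCounting q n) {t : ℝ} (ht : 0 < t) : n t ≤ f (Real.exp 1 * t) := by
  obtain ⟨N, hN, hN'⟩ := hn t ht.le
  refine le_trans ?_ ((hf (Real.exp 1 * t) (by positivity)).1 ⟨N, rfl⟩)
  calc n t = ∑ j ∈ Finset.range N, (1 : ℝ) := by simp [hN]
    _ ≤ _ := by
      refine Finset.sum_le_sum fun j hj => ?_
      have hj' := hq j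
      rw [Real.le_log_iff_exp_le (by positivity), le_div_iff₀ hj']
      gcongr
      exact (hN' j).2 (Finset.mem_range.1 hj)

theorem ExpBounded.associated (hq : ∀ p, 0 < q p) (hmono : Monotone q)
    (hf : IsAssociated q f) (hf0 : f 0 = 0) (hn : IsCounting q n) {l : ℝ} (hl : 0 < l)
    (h : ExpBounded n l) : ExpBounded f (4 * l) := by
  obtain ⟨K, hK, h⟩ := h.le_mul_exp hl
  have h0 := hq 0
  rw [show 4 * l = 2 * (2 * l) by ring]
  refine expBounded_of_le_mul_exp (K / (l * q 0)) fun t ht => ?_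
  rcases ht.eq_or_lt with rfl | ht
  · rw [hf0]; positivity
  · have hexp : t ≤ Real.exp (l * t) / l := by
      rw [le_div_iff₀ hl]
      linarith [Real.add_one_le_exp (l * t)]
    calc f t ≤ n t * (t / q 0) := hf.le_counting_mul hq hmono hn ht
      _ ≤ K * Real.exp (l * t) * (Real.exp (l * t) / l / q 0) := by
        gcongr
        exact h t ht.le
      _ = K / (l * q 0) * Real.exp (2 * l * t) := by
        rw [show 2 * l * t = l * t + l * t by ring, Real.exp_add]
        field_simp

theorem ExpBounded.counting (hq : ∀ p, 0 < q p) (hf : IsAssociated q f) (hn : IsCounting q n)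
    {l : ℝ} (h : ExpBounded f l) : ExpBounded n (Real.exp 1 * l) := by
  obtain ⟨C, hC, h⟩ := h
  have hpos : ∀ t, 0 < t → n t ≤ Real.exp (Real.exp 1 * l * t) + C := fun t ht => by
    refine (hn.le_associated hq hf ht).trans ((h _ (by positivity)).trans_eq ?_)
    congr 2
    ring
  refine ⟨C + n 0, by linarith [hn.nonneg 0 le_rfl], fun t ht => ?_⟩
  rcases ht.eq_or_lt with rfl | ht
  · linarith [Real.exp_pos (Real.exp 1 * l * 0)]
  · linarith [hpos t ht, hn.nonneg 0 le_rfl]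

theorem expBounded_counting_of_summable (hn : IsCounting q n) {μ : ℝ} (hμ : 0 < μ)
    (h : Summable fun p : ℕ => Real.exp (-(μ * q p))) : ExpBounded n (2 * μ) := by
  refine expBounded_of_le_mul_exp (∑' p, Real.exp (-(μ * q p))) fun t ht => ?_
  obtain ⟨N, hN, hN'⟩ := hn t ht
  have hsum : N * Real.exp (-(μ * t)) ≤ ∑' p, Real.exp (-(μ * q p)) := by
    calc N * Real.exp (-(μ * t)) = ∑ j ∈ Finset.range N, Real.exp (-(μ * t)) := by simp
      _ ≤ ∑ j ∈ Finset.range N, Real.exp (-(μ * q j)) := by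
        refine Finset.sum_le_sum fun j hj => ?_
        gcongr
        exact (hN' j).2 (Finset.mem_range.1 hj)
      _ ≤ _ := h.sum_le_tsum _ fun _ _ => (Real.exp_pos _).le
  rw [hN]
  calc (N : ℝ) = N * Real.exp (-(μ * t)) * Real.exp (μ * t) := by
        rw [mul_assoc, ← Real.exp_add]; simp
    _ ≤ _ := by gcongr

theorem ExpBounded.summable (hq : ∀ p, 0 < q p) (hn : IsCounting q n) {l : ℝ} (hl : 0 < l)
    (h : ExpBounded n l) : Summable fun p : ℕ => Real.exp (-(2 * l * q p)) := by
  obtain ⟨K, hK, h⟩ := h.le_mul_exp hl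
  have hs : Summable fun p : ℕ => K ^ 2 * (((p + 1 : ℕ) : ℝ) ^ 2)⁻¹ :=
    (((summable_nat_add_iff (f := fun p : ℕ => ((p : ℝ) ^ 2)⁻¹) 1).2
      (Real.summable_nat_pow_inv.2 one_lt_two))).mul_left _
  refine Summable.of_nonneg_of_le (fun _ => (Real.exp_pos _).le) (fun p => ?_) hs
  obtain ⟨N, hN, hN'⟩ := hn (q p) (hq p).le
  have hp : ((p + 1 : ℕ) : ℝ) ≤ K * Real.exp (l * q p) := by
    refine le_trans ?_ (h (q p) (hq p).le)
    rw [hN]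
    exact_mod_cast (hN' p).1 le_rfl
  have hexp : Real.exp (-(2 * l * q p)) = (Real.exp (l * q p) ^ 2)⁻¹ := by
    rw [Real.exp_neg, ← Real.exp_nat_mul]; congr 2; push_cast; ring
  rw [hexp, ← div_eq_mul_inv, inv_eq_one_div, div_le_div_iff₀ (by positivity) (by positivity),
    one_mul, ← mul_pow]
  gcongr

end Sequences

/-- `M p` dominates `log (p + e) ^ (p + e)` up to the geometric factor `h ^ p`. -/
def LogPowBounded (M : ℕ → ℝ) (h : ℝ) : Prop :=
  ∃ C : ℝ, ∀ p : ℕ,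
    Real.log ((p : ℝ) + Real.exp 1) ^ ((p : ℝ) + Real.exp 1) ≤ C * h ^ p * M p

theorem one_le_log_add_exp_one (p : ℕ) : 1 ≤ Real.log ((p : ℝ) + Real.exp 1) := by
  rw [Real.le_log_iff_exp_le (by positivity)]
  linarith [(Nat.cast_nonneg p : (0 : ℝ) ≤ p)]

theorem log_rpow_exp_one_le {y : ℝ} (hy : Real.exp 1 ≤ y) :
    Real.log y ^ Real.exp 1 ≤ Real.exp y := by
  have hy0 : 0 < y := (Real.exp_pos 1).trans_le hy
  have hlog : 0 ≤ Real.log y := by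
    have := (Real.le_log_iff_exp_le hy0).2 hy
    linarith
  have h1 : Real.log y ≤ y := by linarith [Real.log_le_sub_one_of_pos hy0]
  have h2 : Real.log y * Real.exp 1 ≤ y := by
    have := Real.log_le_sub_one_of_pos (div_pos hy0 (Real.exp_pos 1))
    rw [Real.log_div hy0.ne' (Real.exp_pos 1).ne', Real.log_exp] at this
    rw [← le_div_iff₀ (Real.exp_pos 1)]
    linarith
  calc Real.log y ^ Real.exp 1 ≤ y ^ Real.exp 1 := by gcongr
    _ = Real.exp (Real.log y * Real.exp 1) := Real.rpow_def_of_pos hy0 _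
    _ ≤ Real.exp y := Real.exp_le_exp.2 h2

section WeightSequence

variable {M : ℕ → ℝ} {f : ℝ → ℝ}

theorem ExpBounded.logPowBounded (hpos : ∀ p, 0 < M p)
    (hf : ∀ t : ℝ, 0 < t → IsLUB {y : ℝ | ∃ p : ℕ, y = Real.log (t ^ p * M 0 / M p)} (f t))
    {l : ℝ} (hl : 0 < l) (h : ExpBounded f l) :
    LogPowBounded M (Real.exp 1 ^ 2 * l) := by
  obtain ⟨C, -, h⟩ := h
  refine ⟨Real.exp (C + 2 * Real.exp 1) / M 0, fun p => ?_⟩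
  set y : ℝ := (p : ℝ) + Real.exp 1 with hy
  have hey : Real.exp 1 ≤ y := by linarith [(Nat.cast_nonneg p : (0 : ℝ) ≤ p)]
  have hy0 : 0 < y := (Real.exp_pos 1).trans_le hey
  have hL : 0 < Real.log y := one_pos.trans_le (one_le_log_add_exp_one p)
  have hM := hpos p
  have hM0 := hpos 0
  have h1 := ((hf (Real.log y / l) (by positivity)).1 ⟨p, rfl⟩).trans (h _ (by positivity))
  rw [mul_div_cancel₀ _ hl.ne', Real.exp_log hy0, Real.log_le_iff_le_exp (by positivity),
    div_le_iff₀ hM, div_pow] at h1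
  have h2 : Real.log y ^ p ≤ Real.exp (y + C) * M p * l ^ p / M 0 := by
    rw [le_div_iff₀ hM0]
    calc Real.log y ^ p * M 0 = Real.log y ^ p / l ^ p * M 0 * l ^ p := by field_simp
      _ ≤ _ := by gcongr
  have hexp : Real.exp (y + C) * Real.exp y
      = Real.exp (C + 2 * Real.exp 1) * (Real.exp 1 ^ 2) ^ p := by
    rw [← pow_mul, ← Real.exp_nat_mul, ← Real.exp_add, ← Real.exp_add, hy]
    congr 1; push_cast; ring
  calc Real.log y ^ y = Real.log y ^ p * Real.log y ^ Real.exp 1 := by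
        rw [hy, Real.rpow_add (by rwa [← hy]), Real.rpow_natCast]
    _ ≤ Real.exp (y + C) * M p * l ^ p / M 0 * Real.exp y := by
        gcongr
        exact log_rpow_exp_one_le hey
    _ = Real.exp (y + C) * Real.exp y * M p * l ^ p / M 0 := by ring
    _ = _ := by rw [hexp, mul_pow]; ring

theorem LogPowBounded.expBounded (hpos : ∀ p, 0 < M p) (hf0 : f 0 = 0)
    (hf : ∀ t : ℝ, 0 < t → IsLUB {y : ℝ | ∃ p : ℕ, y = Real.log (t ^ p * M 0 / M p)} (f t))
    {h : ℝ} (hh : 0 < h) (hM : LogPowBounded M h) : ExpBounded f (2 * h) := by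
  obtain ⟨C, hC⟩ := hM
  have hM0 := hpos 0
  have hC0 : 0 < C := by
    have hlt : 0 < C * h ^ 0 * M 0 :=
      (Real.rpow_pos_of_pos (one_pos.trans_le (one_le_log_add_exp_one 0)) _).trans_le (hC 0)
    simpa [hM0] using hlt
  refine ⟨|Real.log (C * M 0)| + 1, by positivity, fun t ht => ?_⟩
  rcases ht.eq_or_lt with rfl | ht
  · rw [hf0]; positivity
  refine (hf t ht).2 ?_
  rintro _ ⟨p, rfl⟩
  have hMp := hpos p
  set y : ℝ := (p : ℝ) + Real.exp 1 with hy
  have hpy : (p : ℝ) ≤ y := by linarith [Real.exp_pos 1]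
  have hy0 : 0 < y := by positivity
  have hp0 : (0 : ℝ) ≤ p := p.cast_nonneg
  have hL : 1 ≤ Real.log y := one_le_log_add_exp_one p
  have hLL : 0 ≤ Real.log (Real.log y) := Real.log_nonneg hL
  have h1 := Real.log_le_log (by positivity) (hC p)
  rw [Real.log_rpow (by linarith), Real.log_mul (by positivity) hMp.ne',
    Real.log_mul hC0.ne' (by positivity), Real.log_pow] at h1
  rw [Real.log_div (by positivity) hMp.ne', Real.log_mul (by positivity) hM0.ne', Real.log_pow]
  have h2 : (p : ℝ) * Real.log t + p * Real.log h - y * Real.log (Real.log y)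
      ≤ Real.exp (2 * h * t) := by
    rw [← mul_add, ← Real.log_mul ht.ne' hh.ne']
    rcases le_total (t * h) (Real.log y) with hle | hle
    · have : p * Real.log (t * h) ≤ y * Real.log (Real.log y) := by
        calc p * Real.log (t * h) ≤ p * Real.log (Real.log y) := by gcongr
          _ ≤ _ := by gcongr
      linarith [Real.exp_pos (2 * h * t)]
    · have hyexp : y ≤ Real.exp (t * h) := (Real.log_le_iff_le_exp hy0).1 hle
      have hlog : Real.log (t * h) ≤ Real.exp (t * h) := by
        linarith [Real.log_le_sub_one_of_pos (mul_pos ht hh), Real.add_one_le_exp (t * h)]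
      have : p * Real.log (t * h) ≤ Real.exp (2 * h * t) := by
        calc p * Real.log (t * h) ≤ p * Real.exp (t * h) := by gcongr
          _ ≤ Real.exp (t * h) * Real.exp (t * h) := by gcongr; exact hpy.trans hyexp
          _ = _ := by rw [← Real.exp_add]; congr 1; ring
      linarith [mul_nonneg hy0.le hLL]
  have h3 := le_abs_self (Real.log (C * M 0))
  rw [Real.log_mul hC0.ne' hM0.ne'] at h3 ⊢
  linarith

theorem monotone_quotients (hpos : ∀ p, 0 < M p)
    (hlogconvex : ∀ p : ℕ, 1 ≤ p → (M p) ^ 2 ≤ M (p - 1) * M (p + 1)) :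
    Monotone fun p : ℕ => M (p + 1) / M p := by
  refine monotone_nat_of_le_succ fun p => ?_
  have h := hlogconvex (p + 1) (by omega)
  rw [div_le_div_iff₀ (hpos _) (hpos _)]
  simp only [Nat.add_sub_cancel] at h
  nlinarith

theorem sum_log_div_quotients (hpos : ∀ p, 0 < M p) {t : ℝ} (ht : 0 < t) (p : ℕ) :
    ∑ j ∈ Finset.range p, Real.log (t / (M (j + 1) / M j)) = Real.log (t ^ p * M 0 / M p) := by
  induction p with
  | zero => simp [(hpos 0).ne']
  | succ p ih =>
    have h0 := hpos 0
    have h1 := hpos p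
    have h2 := hpos (p + 1)
    rw [Finset.sum_range_succ, ih, ← Real.log_mul (by positivity) (by positivity)]
    congr 1
    field_simp
    ring

theorem isAssociated_quotients (hpos : ∀ p, 0 < M p)
    (hf : ∀ t : ℝ, 0 < t → IsLUB {y : ℝ | ∃ p : ℕ, y = Real.log (t ^ p * M 0 / M p)} (f t)) :
    IsAssociated (fun p => M (p + 1) / M p) f := by
  intro t ht
  convert hf t ht using 1
  ext y
  simp only [sum_log_div_quotients hpos ht, mem_range, mem_ofPred_eq, eq_comm]

theorem isCounting_quotients {n : ℝ → ℝ} (hpos : ∀ p, 0 < M p)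
    (hlogconvex : ∀ p : ℕ, 1 ≤ p → (M p) ^ 2 ≤ M (p - 1) * M (p + 1))
    (hquot : Tendsto (fun p : ℕ => M (p + 1) / M p) atTop atTop)
    (hn : ∀ t : ℝ, 0 ≤ t →
      n t = (Nat.card {p : ℕ // 1 ≤ p ∧ M p / M (p - 1) ≤ t} : ℝ)) :
    IsCounting (fun p => M (p + 1) / M p) n := by
  intro t ht
  obtain ⟨N, hN⟩ := exists_le_iff_lt (monotone_quotients hpos hlogconvex) hquot t
  refine ⟨N, ?_, hN⟩
  have hset : {p : ℕ | 1 ≤ p ∧ M p / M (p - 1) ≤ t} = Finset.Icc 1 N := by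
    ext p
    rcases p with _ | p
    · simp
    · simpa [Nat.succ_le_iff] using hN p
  have hcard : Nat.card {p : ℕ | 1 ≤ p ∧ M p / M (p - 1) ≤ t} = N := by
    rw [hset]; simp
  rw [hn t ht]
  exact_mod_cast hcard

end WeightSequence

theorem forall_pos_of_scale {P Q : ℝ → Prop} {c : ℝ} (hc : 0 < c)
    (h : ∀ x, 0 < x → P x → Q (c * x)) (hP : ∀ x, 0 < x → P x) : ∀ x, 0 < x → Q x := by
  intro x hx
  have := h (x / c) (by positivity) (hP _ (by positivity))
  rwa [mul_div_cancel₀ _ hc.ne'] at this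

theorem exists_pos_of_scale {P Q : ℝ → Prop} {c : ℝ} (hc : 0 < c)
    (h : ∀ x, 0 < x → P x → Q (c * x)) (hP : ∃ x, 0 < x ∧ P x) : ∃ x, 0 < x ∧ Q x := by
  obtain ⟨x, hx, hPx⟩ := hP
  exact ⟨c * x, by positivity, h x hx hPx⟩

/-- Characterizations of conditions `(M.5)_0` and `(M.5)_∞` for a weight
sequence `M_p` in terms of its associated function `MA` and counting function `mc`. -/
theorem stmt_4 (M : ℕ → ℝ) (MA mc : ℝ → ℝ)
    (hpos : ∀ p, 0 < M p)
    (hlogconvex : ∀ p : ℕ, 1 ≤ p → (M p) ^ 2 ≤ M (p - 1) * M (p + 1))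
    (hquot : Tendsto (fun p : ℕ => M (p + 1) / M p) atTop atTop)
    (hMA0 : MA 0 = 0)
    (hMA : ∀ t : ℝ, 0 < t →
      IsLUB {y : ℝ | ∃ p : ℕ, y = Real.log (t ^ p * M 0 / M p)} (MA t))
    (hmc : ∀ t : ℝ, 0 ≤ t →
      mc t = (Nat.card {p : ℕ // 1 ≤ p ∧ M p / M (p - 1) ≤ t} : ℝ)) :
    List.TFAE
      [ (∀ μ : ℝ, 0 < μ →
          IntegrableOn (fun t => MA t * Real.exp (-(μ * t))) (Ici (0:ℝ))),
        (∀ μ : ℝ, 0 < μ →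
          IntegrableOn (fun t => mc t * Real.exp (-(μ * t))) (Ici (0:ℝ))),
        (∀ l : ℝ, 0 < l → ∃ C : ℝ, 0 < C ∧ ∀ t : ℝ, 0 ≤ t → MA t ≤ Real.exp (l * t) + C),
        (∀ l : ℝ, 0 < l → ∃ C : ℝ, 0 < C ∧ ∀ t : ℝ, 0 ≤ t → mc t ≤ Real.exp (l * t) + C),
        (∀ μ : ℝ, 0 < μ → Summable (fun p : ℕ => Real.exp (-(μ * (M (p + 1) / M p))))),
        (∀ h : ℝ, 0 < h → ∃ C : ℝ, ∀ p : ℕ,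
          Real.log ((p : ℝ) + Real.exp 1) ^ ((p : ℝ) + Real.exp 1) ≤ C * h ^ p * M p) ]
    ∧
    List.TFAE
      [ (∃ μ : ℝ, 0 < μ ∧
          IntegrableOn (fun t => MA t * Real.exp (-(μ * t))) (Ici (0:ℝ))),
        (∃ μ : ℝ, 0 < μ ∧
          IntegrableOn (fun t => mc t * Real.exp (-(μ * t))) (Ici (0:ℝ))),
        (∃ l : ℝ, 0 < l ∧ ∃ C : ℝ, 0 < C ∧ ∀ t : ℝ, 0 ≤ t → MA t ≤ Real.exp (l * t) + C),
        (∃ l : ℝ, 0 < l ∧ ∃ C : ℝ, 0 < C ∧ ∀ t : ℝ, 0 ≤ t → mc t ≤ Real.exp (l * t) + C),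
        (∃ μ : ℝ, 0 < μ ∧ Summable (fun p : ℕ => Real.exp (-(μ * (M (p + 1) / M p))))),
        (∃ h : ℝ, 0 < h ∧ ∃ C : ℝ, ∀ p : ℕ,
          Real.log ((p : ℝ) + Real.exp 1) ^ ((p : ℝ) + Real.exp 1) ≤ C * h ^ p * M p) ] := by
  have hq : ∀ p : ℕ, 0 < M (p + 1) / M p := fun p => div_pos (hpos _) (hpos _)
  have hmono := monotone_quotients hpos hlogconvex
  have hf := isAssociated_quotients hpos hMA
  have hn := isCounting_quotients hpos hlogconvex hquot hmc
  have h13 := fun μ (hμ : 0 < μ) =>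
    expBounded_of_integrableOn (hf.monotoneOn hq hMA0) (hf.nonneg hMA0) hμ
  have h31 := fun l (hl : 0 < l) =>
    ExpBounded.integrableOn (hf.monotoneOn hq hMA0) (hf.nonneg hMA0) hl
  have h24 := fun μ (hμ : 0 < μ) => expBounded_of_integrableOn hn.monotoneOn hn.nonneg hμ
  have h42 := fun l (hl : 0 < l) => ExpBounded.integrableOn hn.monotoneOn hn.nonneg hl
  have h34 := fun l (_ : 0 < l) => ExpBounded.counting (l := l) hq hf hn
  have h43 := fun l (hl : 0 < l) => ExpBounded.associated hq hmono hf hMA0 hn hl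
  have h54 := fun μ (hμ : 0 < μ) => expBounded_counting_of_summable hn hμ
  have h45 := fun l (hl : 0 < l) => ExpBounded.summable hq hn hl
  have h36 := fun l (hl : 0 < l) => ExpBounded.logPowBounded hpos hMA hl
  have h63 := fun h (hh : 0 < h) => LogPowBounded.expBounded hpos hMA0 hMA hh
  constructor
  · tfae_have 1 → 3 := forall_pos_of_scale two_pos h13
    tfae_have 3 → 1 := forall_pos_of_scale two_pos h31
    tfae_have 2 → 4 := forall_pos_of_scale two_pos h24
    tfae_have 4 → 2 := forall_pos_of_scale two_pos h42
    tfae_have 3 → 4 := forall_pos_of_scale (Real.exp_pos 1) h34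
    tfae_have 4 → 3 := forall_pos_of_scale four_pos h43
    tfae_have 5 → 4 := forall_pos_of_scale two_pos h54
    tfae_have 4 → 5 := forall_pos_of_scale two_pos h45
    tfae_have 3 → 6 := forall_pos_of_scale (by positivity) h36
    tfae_have 6 → 3 := forall_pos_of_scale two_pos h63
    tfae_finish
  · tfae_have 1 → 3 := exists_pos_of_scale two_pos h13
    tfae_have 3 → 1 := exists_pos_of_scale two_pos h31
    tfae_have 2 → 4 := exists_pos_of_scale two_pos h24
    tfae_have 4 → 2 := exists_pos_of_scale two_pos h42
    tfae_have 3 → 4 := exists_pos_of_scale (Real.exp_pos 1) h34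
    tfae_have 4 → 3 := exists_pos_of_scale four_pos h43
    tfae_have 5 → 4 := exists_pos_of_scale two_pos h54
    tfae_have 4 → 5 := exists_pos_of_scale two_pos h45
    tfae_have 3 → 6 := exists_pos_of_scale (by positivity) h36
    tfae_have 6 → 3 := exists_pos_of_scale two_pos h63
    tfae_finish
end

section
/- Let h > 0 and let ω be a weight function satisfying (ε)_{π/h}. Then the function (x,y) ↦ P_h{ω; x, y} is harmonic on the strip T^h₊ = {x+iy : x ∈ ℝ, 0 < y < h} and satisfies P_h{ω; x, y} ≥ (ω(x)/2)(1 − y/h) for all x+iy ∈ T^h₊. If moreover ω satisfies (ε)_{π/(2h)}, then also P_h{ω; x, y} ≤ (ω(2x) + ω(2h/π))(1 − y/h) + C for all x+iy ∈ T^h₊, where C = e/(2h(cosh 1 − 1)) · ∫₀^∞ e^{−πt/(2h)}ω(t) dt < ∞. -/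
open MeasureTheory Set Filter

/-- The Poisson transform of `f` with respect to the strip `0 < y < h`, using the Poisson
kernel `P(x,y) = sin y / (cosh x - cos y)` of the strip `0 < y < π` rescaled by `π/h`. -/
noncomputable def poissonStrip (h : ℝ) (f : ℝ → ℝ) (x y : ℝ) : ℝ :=
  (1 / (2 * h)) * ∫ t : ℝ,
    (Real.sin (Real.pi * y / h) /
      (Real.cosh (Real.pi * (t - x) / h) - Real.cos (Real.pi * y / h))) * f t

theorem integrable_comp_abs_of_integrableOn_Ici {f : ℝ → ℝ} (hf : IntegrableOn f (Ici 0)) :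
    Integrable (fun t => f |t|) := by
  rw [← integrableOn_univ, ← Iic_union_Ici (a := (0 : ℝ)), integrableOn_union]
  constructor
  · have h1 : IntegrableOn (fun t => f (-t)) (Iic 0) := by
      have := (integrableOn_Ici_iff_integrableOn_Ioi (f := f) (b := 0) (μ := volume)).1 hf
      rw [integrableOn_Iic_iff_integrableOn_Iio]
      have h2 := (Measure.measurePreserving_neg (volume : Measure ℝ)).integrableOn_comp_preimage
        (Homeomorph.neg ℝ).measurableEmbedding (f := f) (s := Ioi 0)
      simpa [Function.comp_def] using h2.2 this
    exact h1.congr_fun (fun t ht => by simp only [abs_of_nonpos (mem_Iic.1 ht)]) measurableSet_Iic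
  · exact hf.congr_fun (fun t ht => by simp only [abs_of_nonneg (mem_Ici.1 ht)]) measurableSet_Ici

theorem cosh_sub_cos_pos {θ : ℝ} (hθ : 0 < Real.sin θ) (u : ℝ) :
    0 < Real.cosh u - Real.cos θ := by
  have h1 := Real.one_le_cosh u
  have h2 : Real.cos θ < 1 := by nlinarith [Real.sin_sq_add_cos_sq θ, Real.cos_le_one θ]
  linarith

theorem integrable_stripKernel_and_integral_eq {a θ : ℝ} (ha : 0 < a) (hθ : 0 < θ)
    (hθ' : θ < Real.pi) :
    Integrable (fun s => Real.sin θ / (Real.cosh (a * s) - Real.cos θ)) ∧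
      ∫ s, Real.sin θ / (Real.cosh (a * s) - Real.cos θ) = 2 * (Real.pi - θ) / a := by
  have hs : 0 < Real.sin θ := Real.sin_pos_of_pos_of_lt_pi hθ hθ'
  set g : ℝ → ℝ := fun s => 2 / a * Real.arctan ((Real.exp (a * s) - Real.cos θ) / Real.sin θ)
  have hd : ∀ s ∈ Ici (0 : ℝ),
      HasDerivAt g (Real.sin θ / (Real.cosh (a * s) - Real.cos θ)) s := by
    intro s _
    have h1 : HasDerivAt (fun s => Real.exp (a * s)) (Real.exp (a * s) * a) s := by
      simpa using ((hasDerivAt_id s).const_mul a).exp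
    have h2 := ((((h1.sub_const (Real.cos θ)).div_const (Real.sin θ)).arctan).const_mul (2 / a))
    refine h2.congr_deriv ?_
    have h3 := cosh_sub_cos_pos hs (a * s)
    rw [Real.cosh_eq, Real.exp_neg] at *
    have h4 := Real.exp_pos (a * s)
    set E := Real.exp (a * s)
    have h5 : Real.sin θ ^ 2 + (E - Real.cos θ) ^ 2 = 2 * E * ((E + E⁻¹) / 2 - Real.cos θ) := by
      field_simp
      nlinarith [Real.sin_sq_add_cos_sq θ]
    have h6 : 1 + ((E - Real.cos θ) / Real.sin θ) ^ 2
        = 2 * E * ((E + E⁻¹) / 2 - Real.cos θ) / Real.sin θ ^ 2 := by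
      rw [← h5]; field_simp
    rw [h6]
    generalize (E + E⁻¹) / 2 - Real.cos θ = D at *
    field_simp
  have hp : ∀ s ∈ Ioi (0 : ℝ), 0 ≤ Real.sin θ / (Real.cosh (a * s) - Real.cos θ) :=
    fun s _ => div_nonneg hs.le (cosh_sub_cos_pos hs _).le
  have hl : Tendsto g atTop (nhds (2 / a * (Real.pi / 2))) := by
    refine Tendsto.const_mul _ ?_
    refine (tendsto_nhds_of_tendsto_nhdsWithin Real.tendsto_arctan_atTop).comp ?_
    refine Tendsto.atTop_div_const hs ?_
    refine tendsto_atTop_add_const_right _ _ ?_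
    exact Real.tendsto_exp_atTop.comp (tendsto_id.const_mul_atTop ha)
  have h0 : g 0 = 2 / a * (θ / 2) := by
    have h1 : (1 - Real.cos θ) / Real.sin θ = Real.tan (θ / 2) := by
      have hc : 0 < Real.cos (θ / 2) := Real.cos_pos_of_mem_Ioo ⟨by linarith, by linarith⟩
      have hs2 : 0 < Real.sin (θ / 2) :=
        Real.sin_pos_of_pos_of_lt_pi (by linarith) (by linarith)
      have e1 : Real.sin θ = 2 * Real.sin (θ / 2) * Real.cos (θ / 2) := by
        rw [← Real.sin_two_mul]; ring_nf
      have e2 : Real.cos θ = 2 * Real.cos (θ / 2) ^ 2 - 1 := by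
        rw [← Real.cos_two_mul]; ring_nf
      rw [e1, e2, Real.tan_eq_sin_div_cos]
      field_simp
      nlinarith [Real.sin_sq_add_cos_sq (θ / 2)]
    simp only [g, mul_zero, Real.exp_zero, h1]
    rw [Real.arctan_tan (by linarith) (by linarith)]
  have hi := integrableOn_Ioi_deriv_of_nonneg' hd hp hl
  have he := integral_Ioi_of_hasDerivAt_of_nonneg' hd hp hl
  have habs : ∀ s : ℝ, Real.cosh (a * |s|) = Real.cosh (a * s) := fun s => by
    rw [← Real.cosh_abs (a * s), abs_mul, abs_of_pos ha]
  constructor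
  · have := integrable_comp_abs_of_integrableOn_Ici
      ((integrableOn_Ici_iff_integrableOn_Ioi (b := 0)).2 hi)
    simpa only [habs] using this
  · have := integral_comp_abs (f := fun s => Real.sin θ / (Real.cosh (a * s) - Real.cos θ))
    simp only [habs] at this
    rw [this, he, h0]
    field_simp

theorem abs_sin_im_le_norm_exp_sub_one (w : ℂ) : |Real.sin w.im| ≤ ‖Complex.exp w - 1‖ := by
  rw [← Real.sqrt_sq_eq_abs, Complex.norm_eq_sqrt_sq_add_sq]
  apply Real.sqrt_le_sqrt
  simp only [Complex.sub_re, Complex.sub_im, Complex.exp_re, Complex.exp_im, Complex.one_re,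
    Complex.one_im]
  nlinarith [Real.sin_sq_add_cos_sq w.im, sq_nonneg (Real.exp w.re - Real.cos w.im)]

theorem norm_inv_exp_sub_one_le_inv_sin {w : ℂ} (hw : 0 < Real.sin w.im) :
    ‖(Complex.exp w - 1)⁻¹‖ ≤ (Real.sin w.im)⁻¹ := by
  rw [norm_inv]
  exact inv_anti₀ hw ((le_abs_self _).trans (abs_sin_im_le_norm_exp_sub_one w))

theorem exp_sub_one_ne_zero_of_sin_pos {w : ℂ} (hw : 0 < Real.sin w.im) :
    Complex.exp w - 1 ≠ 0 := by
  rw [← norm_pos_iff]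
  exact hw.trans_le ((le_abs_self _).trans (abs_sin_im_le_norm_exp_sub_one w))

theorem norm_exp_mul_inv_le {w : ℂ} (hw : 0 < Real.sin w.im) :
    ‖Complex.exp w * (Complex.exp w - 1)⁻¹‖ ≤ Real.exp w.re * (Real.sin w.im)⁻¹ := by
  rw [norm_mul, Complex.norm_exp]
  gcongr
  exact norm_inv_exp_sub_one_le_inv_sin hw

theorem norm_exp_mul_inv_le_inv_sin {w : ℂ} (hw : 0 < Real.sin w.im) :
    ‖Complex.exp w * (Complex.exp w - 1)⁻¹‖ ≤ (Real.sin w.im)⁻¹ := by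
  have h1 : Real.sin w.im ≤ ‖Complex.exp (-w) - 1‖ := by
    have := abs_sin_im_le_norm_exp_sub_one (-w)
    rw [Complex.neg_im, Real.sin_neg, abs_neg] at this
    exact (le_abs_self _).trans this
  have h2 : Complex.exp w * (Complex.exp w - 1)⁻¹ = -(Complex.exp (-w) - 1)⁻¹ := by
    have h3 := exp_sub_one_ne_zero_of_sin_pos hw
    have h4 : Complex.exp (-w) - 1 ≠ 0 := norm_pos_iff.1 (hw.trans_le h1)
    have h5 : Complex.exp (-w) * Complex.exp w = 1 := by rw [← Complex.exp_add]; simp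
    rw [← div_eq_mul_inv, ← one_div, ← neg_div, div_eq_div_iff h3 h4]
    linear_combination h5
  rw [h2, norm_neg, norm_inv]
  exact inv_anti₀ hw h1

theorem norm_inv_exp_sub_one_le {w : ℂ} (hw : 0 < Real.sin w.im) :
    ‖(Complex.exp w - 1)⁻¹‖ ≤ Real.exp (-w.re) * (Real.sin w.im)⁻¹ := by
  have h1 : (Complex.exp w - 1)⁻¹
      = Complex.exp (-w) * (Complex.exp w * (Complex.exp w - 1)⁻¹) := by
    rw [← mul_assoc, ← Complex.exp_add]; simp
  rw [h1, norm_mul, Complex.norm_exp, Complex.neg_re]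
  gcongr
  exact norm_exp_mul_inv_le_inv_sin hw

theorem im_inv_exp_sub_one {w : ℂ} (hw : 0 < Real.sin w.im) :
    ((Complex.exp w - 1)⁻¹).im
      = -(Real.sin w.im / (Real.cosh w.re - Real.cos w.im)) / 2 := by
  have h3 := cosh_sub_cos_pos hw w.re
  rw [Complex.inv_im, Complex.normSq_apply]
  simp only [Complex.sub_re, Complex.sub_im, Complex.exp_re, Complex.exp_im, Complex.one_re,
    Complex.one_im, sub_zero]
  rw [Real.cosh_eq, Real.exp_neg] at *
  have h4 := Real.exp_pos w.re
  set E := Real.exp w.re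
  have h5 : (E * Real.cos w.im - 1) * (E * Real.cos w.im - 1)
      + E * Real.sin w.im * (E * Real.sin w.im)
      = 2 * E * ((E + E⁻¹) / 2 - Real.cos w.im) := by
    field_simp
    linear_combination E ^ 2 * Real.sin_sq_add_cos_sq w.im
  rw [h5]
  generalize (E + E⁻¹) / 2 - Real.cos w.im = D at *
  field_simp

/-- A holomorphic kernel whose imaginary part is `-1/2` times the Poisson kernel of the strip. -/
noncomputable def stripCauchyKernel (a t : ℝ) (z : ℂ) : ℂ :=
  (Complex.exp (a * (z - t)) - 1)⁻¹ + if 0 ≤ t then 1 else 0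

theorem im_mul_sub_ofReal (a t : ℝ) (z : ℂ) : (a * (z - t) : ℂ).im = a * z.im := by simp

theorem re_mul_sub_ofReal (a t : ℝ) (z : ℂ) : (a * (z - t) : ℂ).re = a * (z.re - t) := by simp

theorem norm_stripCauchyKernel_le {a : ℝ} (ha : 0 < a) (t : ℝ) {z : ℂ}
    (hz : 0 < Real.sin (a * z.im)) :
    ‖stripCauchyKernel a t z‖
      ≤ Real.exp (a * |z.re|) * (Real.sin (a * z.im))⁻¹ * Real.exp (-(a * |t|)) := by
  have hw : 0 < Real.sin (a * (z - t) : ℂ).im := by rwa [im_mul_sub_ofReal]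
  unfold stripCauchyKernel
  rw [mul_right_comm, ← Real.exp_add]
  split_ifs with ht
  · have h1 : (Complex.exp (a * (z - t)) - 1)⁻¹ + 1
        = Complex.exp (a * (z - t)) * (Complex.exp (a * (z - t)) - 1)⁻¹ := by
      have := exp_sub_one_ne_zero_of_sin_pos hw
      field_simp
      ring
    rw [h1]
    refine (norm_exp_mul_inv_le hw).trans ?_
    rw [im_mul_sub_ofReal, re_mul_sub_ofReal, abs_of_nonneg ht]
    gcongr
    nlinarith [le_abs_self z.re]
  · rw [add_zero]
    refine (norm_inv_exp_sub_one_le hw).trans ?_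
    rw [im_mul_sub_ofReal, re_mul_sub_ofReal, abs_of_neg (not_le.1 ht)]
    gcongr
    nlinarith [neg_abs_le z.re]

theorem norm_deriv_stripCauchyKernel_le {a : ℝ} (ha : 0 < a) (t : ℝ) {z : ℂ}
    (hz : 0 < Real.sin (a * z.im)) :
    ‖-(Complex.exp (a * (z - t)) * a) / (Complex.exp (a * (z - t)) - 1) ^ 2‖
      ≤ a * Real.exp (a * |z.re|) * ((Real.sin (a * z.im))⁻¹) ^ 2 * Real.exp (-(a * |t|)) := by
  have hw : 0 < Real.sin (a * (z - t) : ℂ).im := by rwa [im_mul_sub_ofReal]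
  have hi := inv_pos.2 hz
  have e1 : Real.exp (a * |z.re|) * Real.exp (-(a * |t|)) = Real.exp (a * |z.re| - a * |t|) := by
    rw [← Real.exp_add, sub_eq_add_neg]
  set E := Complex.exp (a * (z - t)) with hE
  rw [show -(E * a) / (E - 1) ^ 2 = -((a : ℂ) * ((E * (E - 1)⁻¹) * (E - 1)⁻¹)) by
    rw [div_eq_mul_inv, ← inv_pow]; ring, norm_neg, norm_mul, norm_mul, Complex.norm_real,
    Real.norm_of_nonneg ha.le,
    show a * Real.exp (a * |z.re|) * ((Real.sin (a * z.im))⁻¹) ^ 2 * Real.exp (-(a * |t|))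
      = a * (Real.exp (a * |z.re|) * Real.exp (-(a * |t|))
        * (Real.sin (a * z.im))⁻¹ * (Real.sin (a * z.im))⁻¹) by ring, e1]
  refine mul_le_mul_of_nonneg_left ?_ ha.le
  have b1 := norm_inv_exp_sub_one_le_inv_sin hw
  rw [im_mul_sub_ofReal] at b1
  rcases le_total 0 t with ht | ht
  · have b2 := norm_exp_mul_inv_le hw
    rw [im_mul_sub_ofReal, re_mul_sub_ofReal] at b2
    refine mul_le_mul (b2.trans ?_) b1 (norm_nonneg _) (by positivity)
    rw [abs_of_nonneg ht]
    gcongr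
    nlinarith [le_abs_self z.re]
  · have b2 := norm_inv_exp_sub_one_le hw
    rw [im_mul_sub_ofReal, re_mul_sub_ofReal] at b2
    have b3 := norm_exp_mul_inv_le_inv_sin hw
    rw [im_mul_sub_ofReal] at b3
    rw [mul_comm]
    refine mul_le_mul (b2.trans ?_) b3 (norm_nonneg _) (by positivity)
    rw [abs_of_nonpos ht]
    gcongr
    nlinarith [neg_abs_le z.re]

theorem hasDerivAt_stripCauchyKernel {a : ℝ} (t : ℝ) {z : ℂ}
    (hz : 0 < Real.sin (a * z.im)) :
    HasDerivAt (stripCauchyKernel a t)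
      (-(Complex.exp (a * (z - t)) * a) / (Complex.exp (a * (z - t)) - 1) ^ 2) z := by
  have hw : 0 < Real.sin (a * (z - t) : ℂ).im := by rwa [im_mul_sub_ofReal]
  have h1 : HasDerivAt (fun z : ℂ => Complex.exp (a * (z - t)) - 1)
      (Complex.exp (a * (z - t)) * a) z := by
    simpa using ((((hasDerivAt_id z).sub_const (t : ℂ)).const_mul (a : ℂ)).cexp).sub_const 1
  exact (h1.inv (exp_sub_one_ne_zero_of_sin_pos hw)).add_const _

theorem measurable_stripCauchyKernel (a : ℝ) (z : ℂ) :
    Measurable (fun t : ℝ => stripCauchyKernel a t z) := by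
  unfold stripCauchyKernel
  refine Measurable.add (by fun_prop) ?_
  exact Measurable.ite measurableSet_Ici measurable_const measurable_const

theorem integrable_stripCauchyKernel_mul {a : ℝ} (ha : 0 < a) {ω : ℝ → ℝ} (hm : Measurable ω)
    (hω : Integrable (fun t => ω t * Real.exp (-(a * |t|)))) {z : ℂ}
    (hz : 0 < Real.sin (a * z.im)) :
    Integrable (fun t => stripCauchyKernel a t z * (ω t : ℂ)) := by
  refine (hω.norm.const_mul (Real.exp (a * |z.re|) * (Real.sin (a * z.im))⁻¹)).mono'
    (((measurable_stripCauchyKernel a z).mul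
      (Complex.measurable_ofReal.comp hm)).aestronglyMeasurable) (Eventually.of_forall fun t => ?_)
  rw [norm_mul, Complex.norm_real, norm_mul, Real.norm_of_nonneg (Real.exp_pos _).le]
  calc _ ≤ (Real.exp (a * |z.re|) * (Real.sin (a * z.im))⁻¹ * Real.exp (-(a * |t|))) * ‖ω t‖ := by
        gcongr
        exact norm_stripCauchyKernel_le ha t hz
    _ = _ := by ring

theorem differentiableAt_integral_stripCauchyKernel {a : ℝ} (ha : 0 < a) {ω : ℝ → ℝ}
    (hm : Measurable ω) (hω : Integrable (fun t => ω t * Real.exp (-(a * |t|)))) {z : ℂ}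
    (hz : 0 < Real.sin (a * z.im)) :
    DifferentiableAt ℂ (fun z => ∫ t, stripCauchyKernel a t z * (ω t : ℂ)) z := by
  set m := Real.sin (a * z.im) / 2 with hmdef
  have hm0 : 0 < m := by positivity
  set s : Set ℂ := {w | |w.re| < |z.re| + 1 ∧ m < Real.sin (a * w.im)} with hs
  have hso : IsOpen s := by
    have h1 : IsOpen {w : ℂ | |w.re| < |z.re| + 1} := isOpen_lt (by fun_prop) (by fun_prop)
    have h2 : IsOpen {w : ℂ | m < Real.sin (a * w.im)} := isOpen_lt (by fun_prop) (by fun_prop)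
    exact h1.inter h2
  have hzs : z ∈ s := ⟨by linarith, by rw [hmdef]; linarith⟩
  have hn : s ∈ nhds z := hso.mem_nhds hzs
  refine (hasDerivAt_integral_of_dominated_loc_of_deriv_le hn
    (F' := fun w t => (-(Complex.exp (a * (w - t)) * a) / (Complex.exp (a * (w - t)) - 1) ^ 2)
      * (ω t : ℂ))
    (bound := fun t => a * Real.exp (a * (|z.re| + 1)) * (m⁻¹) ^ 2
      * ‖ω t * Real.exp (-(a * |t|))‖)
    ?_ (integrable_stripCauchyKernel_mul ha hm hω hz) ?_ ?_ (hω.norm.const_mul _)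
    ?_).2.differentiableAt
  · filter_upwards [hn] with w hw
    exact (integrable_stripCauchyKernel_mul ha hm hω (hm0.trans hw.2)).aestronglyMeasurable
  · exact Measurable.aestronglyMeasurable (by fun_prop)
  · refine Eventually.of_forall fun t w hw => ?_
    have hw0 := hm0.trans hw.2
    rw [norm_mul, Complex.norm_real, norm_mul, Real.norm_of_nonneg (Real.exp_pos _).le]
    calc _ ≤ (a * Real.exp (a * |w.re|) * ((Real.sin (a * w.im))⁻¹) ^ 2
          * Real.exp (-(a * |t|))) * ‖ω t‖ := by
          gcongr
          exact norm_deriv_stripCauchyKernel_le ha t hw0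
      _ ≤ (a * Real.exp (a * (|z.re| + 1)) * (m⁻¹) ^ 2
          * Real.exp (-(a * |t|))) * ‖ω t‖ := by
          gcongr
          · exact hw.1.le
          · exact hw.2.le
      _ = _ := by ring
  · exact Eventually.of_forall fun t w hw =>
      (hasDerivAt_stripCauchyKernel t (hm0.trans hw.2)).mul_const _

theorem im_stripCauchyKernel_mul {a : ℝ} (t : ℝ) {z : ℂ} (hz : 0 < Real.sin (a * z.im)) (r : ℝ) :
    (stripCauchyKernel a t z * (r : ℂ)).im
      = -(1 / 2) * ((Real.sin (a * z.im)
        / (Real.cosh (a * (t - z.re)) - Real.cos (a * z.im))) * r) := by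
  have hw : 0 < Real.sin (a * (z - t) : ℂ).im := by rwa [im_mul_sub_ofReal]
  have h1 : ((if 0 ≤ t then 1 else 0 : ℂ)).im = 0 := by split_ifs <;> simp
  rw [Complex.im_mul_ofReal, stripCauchyKernel, Complex.add_im, h1, im_inv_exp_sub_one hw,
    im_mul_sub_ofReal, re_mul_sub_ofReal, ← Real.cosh_neg, ← mul_neg, neg_sub]
  ring

theorem integrable_stripKernel_mul {a : ℝ} (ha : 0 < a) {ω : ℝ → ℝ} (hm : Measurable ω)
    (hω : Integrable (fun t => ω t * Real.exp (-(a * |t|)))) (x : ℝ) {y : ℝ}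
    (hy : 0 < Real.sin (a * y)) :
    Integrable (fun t => (Real.sin (a * y)
        / (Real.cosh (a * (t - x)) - Real.cos (a * y))) * ω t) := by
  have h1 := (integrable_stripCauchyKernel_mul ha hm hω (z := ⟨x, y⟩) hy).im.const_mul (-2)
  refine h1.congr (Eventually.of_forall fun t => ?_)
  have := im_stripCauchyKernel_mul (a := a) t (z := ⟨x, y⟩) hy (ω t)
  simp only [RCLike.im_to_complex, this]
  ring

theorem poissonStrip_eq (h : ℝ) (f : ℝ → ℝ) (x y : ℝ) :
    poissonStrip h f x y = (1 / (2 * h)) * ∫ t : ℝ, (Real.sin (Real.pi / h * y) /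
      (Real.cosh (Real.pi / h * (t - x)) - Real.cos (Real.pi / h * y))) * f t := by
  simp only [poissonStrip, mul_div_right_comm]

theorem poissonStrip_eq_im {h : ℝ} (hh : 0 < h) {ω : ℝ → ℝ} (hm : Measurable ω)
    (hω : Integrable (fun t => ω t * Real.exp (-(Real.pi / h * |t|)))) (x : ℝ) {y : ℝ}
    (hy : 0 < Real.sin (Real.pi / h * y)) :
    poissonStrip h ω x y
      = (-(1 / h : ℂ) *
        ∫ t, stripCauchyKernel (Real.pi / h) t (x + y * Complex.I) * (ω t : ℂ)).im := by
  have hz : 0 < Real.sin (Real.pi / h * (x + y * Complex.I : ℂ).im) := by simpa using hy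
  have hi := integrable_stripCauchyKernel_mul (by positivity) hm hω hz
  have h1 := integral_im hi
  simp only [RCLike.im_to_complex, im_stripCauchyKernel_mul _ hz] at h1
  rw [show (-(1 / h : ℂ)) = ((-(1 / h) : ℝ) : ℂ) by push_cast; rfl, Complex.im_ofReal_mul, ← h1,
    integral_const_mul, poissonStrip_eq]
  simp
  ring

theorem HasDerivAt.im_comp_add_ofReal_mul_I {f : ℂ → ℂ} {f' : ℂ} {x y : ℝ}
    (hf : HasDerivAt f f' (x + y * Complex.I)) :
    HasDerivAt (fun x' : ℝ => (f (x' + y * Complex.I)).im) f'.im x := by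
  have h1 : HasDerivAt (fun x' : ℝ => (x' + y * Complex.I : ℂ)) 1 x :=
    (Complex.ofRealCLM.hasDerivAt (x := x)).add_const _
  simpa [Function.comp_def] using! (Complex.imCLM.hasFDerivAt.comp_hasDerivAt x (hf.comp x h1))

theorem HasDerivAt.comp_ofReal_add_mul_I {f : ℂ → ℂ} {f' : ℂ} {x y : ℝ}
    (hf : HasDerivAt f f' (x + y * Complex.I)) :
    HasDerivAt (fun y' : ℝ => f (x + y' * Complex.I)) (f' * Complex.I) y := by
  have h1 : HasDerivAt (fun y' : ℝ => (x + y' * Complex.I : ℂ)) Complex.I y := by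
    simpa using ((Complex.ofRealCLM.hasDerivAt (x := y)).mul_const Complex.I).const_add (x : ℂ)
  exact hf.comp y h1

theorem deriv_deriv_im_add_deriv_deriv_im_eq_zero {f : ℂ → ℂ} {U : Set ℂ} (hU : IsOpen U)
    (hf : DifferentiableOn ℂ f U) {x y : ℝ} (hz : (x + y * Complex.I : ℂ) ∈ U) :
    deriv (deriv (fun x' : ℝ => (f (x' + y * Complex.I)).im)) x
      + deriv (deriv (fun y' : ℝ => (f (x + y' * Complex.I)).im)) y = 0 := by
  have hd : ∀ z ∈ U, HasDerivAt f (deriv f z) z := fun z hz =>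
    (hf.differentiableAt (hU.mem_nhds hz)).hasDerivAt
  have hd2 := ((hf.deriv hU).differentiableAt (hU.mem_nhds hz)).hasDerivAt
  have ex : deriv (fun x' : ℝ => (f (x' + y * Complex.I)).im)
      =ᶠ[nhds x] fun x' => (deriv f (x' + y * Complex.I)).im := by
    have hc : Continuous (fun x' : ℝ => (x' + y * Complex.I : ℂ)) := by fun_prop
    filter_upwards [hc.continuousAt.preimage_mem_nhds (hU.mem_nhds hz)] with x' hx'
    exact (hd _ hx').im_comp_add_ofReal_mul_I.deriv
  have ey : deriv (fun y' : ℝ => (f (x + y' * Complex.I)).im)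
      =ᶠ[nhds y] fun y' => (deriv f (x + y' * Complex.I)).re := by
    have hc : Continuous (fun y' : ℝ => (x + y' * Complex.I : ℂ)) := by fun_prop
    filter_upwards [hc.continuousAt.preimage_mem_nhds (hU.mem_nhds hz)] with y' hy'
    have := Complex.imCLM.hasFDerivAt.comp_hasDerivAt y' (hd _ hy').comp_ofReal_add_mul_I
    simpa [Function.comp_def] using this.deriv
  have h2 := (Complex.reCLM.hasFDerivAt.comp_hasDerivAt y hd2.comp_ofReal_add_mul_I).deriv
  rw [ex.deriv_eq, ey.deriv_eq, hd2.im_comp_add_ofReal_mul_I.deriv]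
  simp only [Function.comp_def, Complex.reCLM_apply] at h2
  rw [h2]
  simp

theorem inv_sinh_le {v : ℝ} (hv : 1 ≤ v) :
    (Real.sinh v)⁻¹ ≤ Real.exp 1 / (2 * (Real.cosh 1 - 1)) * Real.exp (-v) := by
  have hs : 0 < Real.sinh v := Real.sinh_pos_iff.2 (by linarith)
  have hc : 0 < Real.cosh 1 - 1 := by
    have := Real.one_lt_cosh.2 (one_ne_zero (α := ℝ))
    linarith
  have hE : 1 ≤ Real.exp 1 := Real.one_le_exp zero_le_one
  have hE3 : Real.exp 1 ≤ 3 := by linarith [Real.exp_one_lt_d9]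
  have hV : Real.exp 1 ≤ Real.exp v := Real.exp_le_exp.2 hv
  rw [inv_le_iff_one_le_mul₀ hs, Real.exp_neg,
    show Real.exp 1 / (2 * (Real.cosh 1 - 1)) * (Real.exp v)⁻¹ * Real.sinh v
      = (Real.exp 1 * Real.sinh v) / (2 * (Real.cosh 1 - 1) * Real.exp v) by field_simp,
    one_le_div (by positivity)]
  rw [Real.cosh_eq, Real.sinh_eq, Real.exp_neg, Real.exp_neg]
  set E := Real.exp 1
  set V := Real.exp v
  have h1 : E + E⁻¹ - 2 ≤ (E - E⁻¹) / 2 := by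
    have : (E - E⁻¹) / 2 - (E + E⁻¹ - 2) = (E - 1) * (3 - E) / (2 * E) := by
      field_simp; ring
    have : 0 ≤ (E - 1) * (3 - E) / (2 * E) :=
      div_nonneg (mul_nonneg (by linarith) (by linarith)) (by linarith)
    linarith
  have h2 : E * V⁻¹ ≤ V * E⁻¹ := by
    rw [← div_eq_mul_inv, ← div_eq_mul_inv, div_le_div_iff₀ (by linarith) (by linarith)]
    nlinarith
  have h3 : (E + E⁻¹ - 2) * V ≤ (E - E⁻¹) / 2 * V := by gcongr
  nlinarith

theorem stripKernel_le_of_one_le {θ u v : ℝ} (hθ : 0 < Real.sin θ) (hv : 1 ≤ v) (huv : v ≤ |u|) :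
    Real.sin θ / (Real.cosh u - Real.cos θ)
      ≤ Real.exp 1 / (2 * (Real.cosh 1 - 1)) * Real.exp (-v) := by
  refine le_trans ?_ (inv_sinh_le hv)
  have hs : 0 < Real.sinh v := Real.sinh_pos_iff.2 (by linarith)
  have hcosh : Real.cosh v ≤ Real.cosh u := by
    rw [Real.cosh_le_cosh, abs_of_nonneg (by linarith)]; exact huv
  have h1 : Real.sin θ * Real.sinh v + Real.cos θ ≤ Real.cosh v := by
    refine abs_le_of_sq_le_sq' ?_ (Real.cosh_pos v).le |>.2
    nlinarith [Real.sin_sq_add_cos_sq θ, Real.cosh_sq v,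
      sq_nonneg (Real.sin θ - Real.cos θ * Real.sinh v)]
  rw [div_le_iff₀ (cosh_sub_cos_pos hθ u), inv_mul_eq_div, le_div_iff₀ hs]
  linarith

/-- For a weight function `ω` satisfying `(ε)_{π/h}` the Poisson transform
`P_h{ω; x, y}` is harmonic on the strip `0 < y < h` and bounded below by
`(ω(x)/2)(1 - y/h)`; if moreover `ω` satisfies `(ε)_{π/(2h)}`, it is bounded above by
`(ω(2x) + ω(2h/π))(1 - y/h) + C` with the explicit constant `C`. -/
theorem stmt_5 (h : ℝ) (hh : 0 < h) (ω : ℝ → ℝ)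
    (hnn : ∀ t, 0 ≤ ω t)
    (hmono : MonotoneOn ω (Ici (0:ℝ)))
    (heven : ∀ t : ℝ, ω t = ω |t|)
    (hε : IntegrableOn (fun t => ω t * Real.exp (-(Real.pi / h * t))) (Ici (0:ℝ))) :
    -- harmonicity on the strip
    (ContDiffOn ℝ 2 (fun p : ℝ × ℝ => poissonStrip h ω p.1 p.2)
        {p : ℝ × ℝ | 0 < p.2 ∧ p.2 < h} ∧
      ∀ x y : ℝ, 0 < y → y < h →
        deriv (deriv (fun x' => poissonStrip h ω x' y)) x +
          deriv (deriv (fun y' => poissonStrip h ω x y')) y = 0) ∧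
    -- lower bound
    (∀ x y : ℝ, 0 < y → y < h →
      ω x / 2 * (1 - y / h) ≤ poissonStrip h ω x y) ∧
    -- upper bound under (ε)_{π/(2h)}
    (IntegrableOn (fun t => ω t * Real.exp (-(Real.pi / (2 * h) * t))) (Ici (0:ℝ)) →
      ∀ x y : ℝ, 0 < y → y < h →
        poissonStrip h ω x y ≤ (ω (2 * x) + ω (2 * h / Real.pi)) * (1 - y / h) +
          Real.exp 1 / (2 * h * (Real.cosh 1 - 1)) *
            ∫ t in Ici (0:ℝ), Real.exp (-(Real.pi / (2 * h) * t)) * ω t) := by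
  have ha : 0 < Real.pi / h := div_pos Real.pi_pos hh
  have hm : Measurable ω := by
    have h1 : Monotone (fun t => ω (max t 0)) := fun s t hst =>
      hmono (mem_Ici.2 (le_max_right _ _)) (mem_Ici.2 (le_max_right _ _))
        (max_le_max_right 0 hst)
    convert h1.measurable.comp (measurable_id.abs) using 1
    ext t
    simp [heven t]
  have hle : ∀ {s t : ℝ}, |s| ≤ |t| → ω s ≤ ω t := fun {s t} hst => by
    rw [heven s, heven t]
    exact hmono (abs_nonneg s) (abs_nonneg t) hst
  have hω : Integrable (fun t => ω t * Real.exp (-(Real.pi / h * |t|))) := by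
    simpa only [← heven] using integrable_comp_abs_of_integrableOn_Ici hε
  have hrange : ∀ {y : ℝ}, 0 < y → y < h →
      0 < Real.pi / h * y ∧ Real.pi / h * y < Real.pi := fun {y} hy0 hy => by
    refine ⟨by positivity, ?_⟩
    calc Real.pi / h * y < Real.pi / h * h := by gcongr
      _ = Real.pi := by field_simp
  have hsin : ∀ {y : ℝ}, 0 < y → y < h → 0 < Real.sin (Real.pi / h * y) := fun hy0 hy =>
    Real.sin_pos_of_pos_of_lt_pi (hrange hy0 hy).1 (hrange hy0 hy).2
  have hmass : ∀ {y : ℝ}, 2 * (Real.pi - Real.pi / h * y) / (Real.pi / h)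
      = 2 * h * (1 - y / h) := fun {y} => by
    have := Real.pi_pos
    field_simp
  set F : ℂ → ℂ := fun z =>
    -(1 / h : ℂ) * ∫ t, stripCauchyKernel (Real.pi / h) t z * (ω t : ℂ) with hF
  set U : Set ℂ := {z | 0 < Real.sin (Real.pi / h * z.im)} with hUdef
  have hU : IsOpen U := isOpen_lt (by fun_prop) (by fun_prop)
  have hFd : DifferentiableOn ℂ F U := fun z hz =>
    ((differentiableAt_integral_stripCauchyKernel ha hm hω hz).const_mul _).differentiableWithinAt
  have hmem : ∀ (x : ℝ) {y : ℝ}, 0 < y → y < h → (x + y * Complex.I : ℂ) ∈ U :=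
    fun x y hy0 hy => by simpa [hUdef] using hsin hy0 hy
  have heq : ∀ (x : ℝ) {y : ℝ}, 0 < y → y < h →
      poissonStrip h ω x y = (F (x + y * Complex.I)).im := fun x y hy0 hy =>
    poissonStrip_eq_im hh hm hω x (hsin hy0 hy)
  refine ⟨⟨?_, ?_⟩, ?_, ?_⟩
  · have h1 : ContDiffOn ℝ 2 F U := (hFd.contDiffOn hU).restrict_scalars ℝ
    have h2 : ContDiff ℝ 2 (fun p : ℝ × ℝ => (p.1 + p.2 * Complex.I : ℂ)) :=
      (Complex.ofRealCLM.contDiff.comp contDiff_fst).add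
        ((Complex.ofRealCLM.contDiff.comp contDiff_snd).mul contDiff_const)
    refine ((Complex.imCLM.contDiff.comp_contDiffOn (h1.comp h2.contDiffOn
      (fun p hp => hmem p.1 hp.1 hp.2)))).congr fun p hp => ?_
    exact heq p.1 hp.1 hp.2
  · intro x y hy0 hy
    have h1 : (fun x' => poissonStrip h ω x' y) = fun x' : ℝ => (F (x' + y * Complex.I)).im :=
      funext fun x' => heq x' hy0 hy
    have h2 : (fun y' => poissonStrip h ω x y')
        =ᶠ[nhds y] fun y' : ℝ => (F (x + y' * Complex.I)).im := by
      filter_upwards [Ioo_mem_nhds hy0 hy] with y' hy'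
      exact heq x hy'.1 hy'.2
    rw [h1, h2.deriv.deriv_eq]
    exact deriv_deriv_im_add_deriv_deriv_im_eq_zero hU hFd (hmem x hy0 hy)
  · intro x y hy0 hy
    obtain ⟨hki, hk⟩ := integrable_stripKernel_and_integral_eq ha (hrange hy0 hy).1
      (hrange hy0 hy).2
    have hi := integrable_stripKernel_mul ha hm hω x (hsin hy0 hy)
    rw [poissonStrip_eq]
    set k : ℝ → ℝ := fun s => Real.sin (Real.pi / h * y) /
      (Real.cosh (Real.pi / h * s) - Real.cos (Real.pi / h * y)) with hkdef
    have hk0 : ∀ s, 0 ≤ k s := fun s =>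
      div_nonneg (hsin hy0 hy).le (cosh_sub_cos_pos (hsin hy0 hy) _).le
    have hkeven : ∀ s, k (-s) = k s := fun s => by simp [hkdef]
    change Integrable (fun t => k (t - x) * ω t) at hi
    change _ ≤ 1 / (2 * h) * ∫ t, k (t - x) * ω t
    have e1 : ∫ s, k s * ω (x + s) = ∫ t, k (t - x) * ω t := by
      rw [← integral_add_left_eq_self (fun t => k (t - x) * ω t) x]
      simp
    have e2 : ∫ s, k s * ω (x - s) = ∫ t, k (t - x) * ω t := by
      rw [← integral_sub_left_eq_self (fun t => k (t - x) * ω t) volume x]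
      simp [hkeven]
    have i1 : Integrable (fun s => k s * ω (x + s)) := by
      simpa using hi.comp_add_left x
    have i2 : Integrable (fun s => k s * ω (x - s)) := by
      simpa [hkeven] using hi.comp_sub_left x
    have h1 : ∫ s, k s * ω x ≤ ∫ s, (k s * ω (x + s) + k s * ω (x - s)) := by
      refine integral_mono (hki.mul_const _) (i1.add i2) fun s => ?_
      simp only
      rw [← mul_add]
      refine mul_le_mul_of_nonneg_left ?_ (hk0 s)
      have h2 : |x| ≤ |x + s| ∨ |x| ≤ |x - s| := by
        by_contra! hcon
        have := abs_add_le (x + s) (x - s)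
        rw [show x + s + (x - s) = 2 * x by ring, abs_mul, abs_two] at this
        linarith [hcon.1, hcon.2]
      rcases h2 with h2 | h2
      · linarith [hle h2, hnn (x - s)]
      · linarith [hle h2, hnn (x + s)]
    rw [integral_add i1 i2, e1, e2, integral_mul_const, hk, hmass] at h1
    calc ω x / 2 * (1 - y / h) = 1 / (2 * h) * (2 * h * (1 - y / h) * ω x / 2) := by
          field_simp
      _ ≤ _ := by
          gcongr
          linarith
  · intro hε2 x y hy0 hy
    obtain ⟨hki, hk⟩ := integrable_stripKernel_and_integral_eq ha (hrange hy0 hy).1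
      (hrange hy0 hy).2
    have hi := integrable_stripKernel_mul ha hm hω x (hsin hy0 hy)
    have hω2 : Integrable (fun t => Real.exp (-(Real.pi / (2 * h) * |t|)) * ω t) := by
      simpa only [← heven, mul_comm (ω _)] using integrable_comp_abs_of_integrableOn_Ici hε2
    have hwt := integral_comp_abs (f := fun t => Real.exp (-(Real.pi / (2 * h) * t)) * ω t)
    simp only [← heven] at hwt
    rw [← integral_Ici_eq_integral_Ioi] at hwt
    rw [poissonStrip_eq]
    set k : ℝ → ℝ := fun s => Real.sin (Real.pi / h * y) /
      (Real.cosh (Real.pi / h * s) - Real.cos (Real.pi / h * y)) with hkdef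
    have hk0 : ∀ s, 0 ≤ k s := fun s =>
      div_nonneg (hsin hy0 hy).le (cosh_sub_cos_pos (hsin hy0 hy) _).le
    change Integrable (fun t => k (t - x) * ω t) at hi
    change 1 / (2 * h) * ∫ t, k (t - x) * ω t ≤ _
    set c := Real.exp 1 / (2 * (Real.cosh 1 - 1)) with hc
    have hc0 : 0 < c := by
      have := Real.one_lt_cosh.2 (one_ne_zero (α := ℝ))
      exact div_pos (Real.exp_pos 1) (by linarith)
    have hpt : ∀ t, k (t - x) * ω t ≤ k (t - x) * (ω (2 * x) + ω (2 * h / Real.pi))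
        + c * (Real.exp (-(Real.pi / (2 * h) * |t|)) * ω t) := fun t => by
      have hpi := Real.pi_pos
      have p1 : 0 ≤ c * (Real.exp (-(Real.pi / (2 * h) * |t|)) * ω t) := by
        have := hnn t
        positivity
      have p2 := hk0 (t - x)
      by_cases hsmall : |t| ≤ |2 * x| ∨ |t| ≤ |2 * h / Real.pi|
      · have h1 : ω t ≤ ω (2 * x) + ω (2 * h / Real.pi) := by
          rcases hsmall with h2 | h2
          · linarith [hle h2, hnn (2 * h / Real.pi)]
          · linarith [hle h2, hnn (2 * x)]
        linarith [mul_le_mul_of_nonneg_left h1 p2]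
      · push Not at hsmall
        obtain ⟨h1, h2⟩ := hsmall
        rw [abs_mul, abs_two] at h1
        rw [abs_of_pos (by positivity), div_lt_iff₀ hpi] at h2
        have h3 : 1 ≤ Real.pi / (2 * h) * |t| := by
          rw [div_mul_eq_mul_div, one_le_div (by positivity)]
          linarith
        have h4 : Real.pi / (2 * h) * |t| ≤ |Real.pi / h * (t - x)| := by
          rw [abs_mul, abs_of_pos ha]
          have h5 := abs_sub_abs_le_abs_sub t x
          calc Real.pi / (2 * h) * |t| = Real.pi / h * (|t| / 2) := by field_simp
            _ ≤ _ := by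
              gcongr
              linarith
        have h6 : k (t - x) ≤ c * Real.exp (-(Real.pi / (2 * h) * |t|)) :=
          stripKernel_le_of_one_le (hsin hy0 hy) h3 h4
        have h7 := mul_le_mul_of_nonneg_right h6 (hnn t)
        have h8 := mul_nonneg p2 (add_nonneg (hnn (2 * x)) (hnn (2 * h / Real.pi)))
        linarith
    have i1 : Integrable (fun t => k (t - x) * (ω (2 * x) + ω (2 * h / Real.pi))) :=
      (hki.comp_sub_right x).mul_const _
    have h1 := integral_mono hi (i1.add (hω2.const_mul c)) hpt
    simp only [Pi.add_apply] at h1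
    rw [integral_add i1 (hω2.const_mul c), integral_mul_const, integral_const_mul, hwt,
      integral_sub_right_eq_self k x, hk, hmass] at h1
    calc _ ≤ 1 / (2 * h) * _ := mul_le_mul_of_nonneg_left h1 (by positivity)
      _ = _ := by
        rw [hc]
        have := Real.one_lt_cosh.2 (one_ne_zero (α := ℝ))
        have : Real.cosh 1 - 1 ≠ 0 := by linarith
        field_simp
end
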